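/- arXiv:0711.4880 — 2 statements merged into one kernel-verified Lean document; each statement's English description precedes it below -/
import Mathlib

section
/- Let A be a Noetherian ring and 𝔭 a prime ideal of A with height g ≥ 2. Let k ≥ 2 and let Q = (a_1, …, a_g) be an ideal generated by an A-regular sequence a_1, …, a_g contained in the k-th symbolic power 𝔭^{(k)}. Assume one of the following: (i) the localization A_𝔭 is not a regular local ring; (ii) A_𝔭 is regular local and g ≥ 3; (iii) A_𝔭 is regular local, g = 2, and a_i ∈ 𝔭^{(k+1)} for all 1 ≤ i ≤ g. Then for every ideal I with Q ⊆ I ⊆ (Q : 𝔭^{(k)}), one has r_Q(I) ≤ μ_A((Q : 𝔭^{(k)})/Q) + 1. -/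
/-- The reduction number `r_Q(I) = inf { n ≥ 0 | I^(n+1) = Q·I^n }`. -/
noncomputable def redNum {A : Type*} [CommRing A] (Q I : Ideal A) : ℕ∞ :=
  sInf {n : ℕ∞ | ∃ m : ℕ, n = (m : ℕ∞) ∧ I ^ (m + 1) = Q * I ^ m}

/-- `a 0, …, a (m-1)` is a regular sequence on `A`: each `a i` is a nonzerodivisor
modulo the ideal generated by the preceding elements, and the whole sequence
generates a proper ideal. -/
def IsRegularSeq {A : Type*} [CommRing A] {m : ℕ} (a : Fin m → A) : Prop :=
  (∀ i : Fin m, ∀ x : A,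
      a i * x ∈ Ideal.span (a '' {j | j < i}) → x ∈ Ideal.span (a '' {j | j < i})) ∧
    Ideal.span (Set.range a) ≠ ⊤

/-- The `k`-th symbolic power `p^{(k)} = p^k A_p ∩ A` of a prime ideal `p`. -/
noncomputable def symbolicPow {A : Type*} [CommRing A] (p : Ideal A) [p.IsPrime]
    (k : ℕ) : Ideal A :=
  (p.map (algebraMap A (Localization.AtPrime p)) ^ k).comap
    (algebraMap A (Localization.AtPrime p))

/-- `R` is a regular local ring: a Noetherian local ring whose maximal ideal is
generated by `dim R` elements. -/
def IsRegLocalRing (R : Type*) [CommRing R] : Prop :=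
  IsNoetherianRing R ∧ ∃ _h : IsLocalRing R, ∃ s : Finset R,
    Ideal.span (↑s : Set R) = IsLocalRing.maximalIdeal R ∧
      (s.card : WithBot ℕ∞) = ringKrullDim R

theorem mul_prod_sub_prod_mem {A ι : Type*} [CommRing A] {Q I : Ideal A} (hQI : Q ≤ I)
    (s : Finset ι) (u v : ι → A) (hv : ∀ i, v i ∈ I) (huv : ∀ i, u i - v i ∈ Q)
    {x : A} (hx : x ∈ I) :
    x * (∏ i ∈ s, u i - ∏ i ∈ s, v i) ∈ Q * I ^ s.card := by
  classical
  have hu : ∀ i, u i ∈ I := fun i => by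
    simpa using add_mem (hQI (huv i)) (hv i)
  induction s using Finset.induction_on with
  | empty => simp
  | insert i s his ih =>
    rw [Finset.prod_insert his, Finset.prod_insert his, Finset.card_insert_of_notMem his]
    have h1 : (u i - v i) * (x * ∏ j ∈ s, u j) ∈ Q * I ^ (s.card + 1) := by
      refine Ideal.mul_mem_mul (huv i) ?_
      rw [pow_succ']
      refine Ideal.mul_mem_mul hx ?_
      rw [← Finset.prod_const]
      exact Ideal.prod_mem_prod fun j _ => hu j
    have h2 : v i * (x * (∏ j ∈ s, u j - ∏ j ∈ s, v j)) ∈ Q * I ^ (s.card + 1) := by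
      rw [pow_succ', ← mul_assoc, mul_comm Q I, mul_assoc]
      exact Ideal.mul_mem_mul (hv i) ih
    convert add_mem h1 h2 using 1
    ring

theorem Matrix.det_mem_pow {A n : Type*} [CommRing A] [Fintype n] [DecidableEq n] {I : Ideal A}
    (M : Matrix n n A) (hM : ∀ i j, M i j ∈ I) : M.det ∈ I ^ Fintype.card n := by
  rw [Matrix.det_apply]
  refine Ideal.sum_mem _ fun σ _ => ?_
  rw [Units.smul_def]
  refine zsmul_mem ?_ _
  rw [Fintype.card, ← Finset.prod_const]
  exact Ideal.prod_mem_prod fun j _ => hM _ _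

theorem Matrix.mul_det_sub_det_mem {A n : Type*} [CommRing A] [Fintype n] [DecidableEq n]
    {Q I : Ideal A} (hQI : Q ≤ I) (M N : Matrix n n A) (hN : ∀ i j, N i j ∈ I)
    (hMN : ∀ i j, M i j - N i j ∈ Q) {x : A} (hx : x ∈ I) :
    x * (M.det - N.det) ∈ Q * I ^ Fintype.card n := by
  rw [Matrix.det_apply, Matrix.det_apply, ← Finset.sum_sub_distrib, Finset.mul_sum]
  refine Ideal.sum_mem _ fun σ _ => ?_
  rw [← smul_sub, mul_smul_comm, Units.smul_def]
  exact zsmul_mem (mul_prod_sub_prod_mem hQI _ _ _ (fun i => hN _ _) (fun i => hMN _ _) hx) _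

theorem Matrix.mul_adjugate_mem {A n : Type*} [CommRing A] [Fintype n] [DecidableEq n]
    {Q I : Ideal A} (hQI : Q ≤ I) (M : Matrix n n A) (hM : ∀ i j, M i j ∈ I) {q : A} (hq : q ∈ Q)
    (i j : n) : q * M.adjugate i j ∈ I ^ Fintype.card n := by
  rw [Matrix.adjugate_apply, ← Matrix.det_updateRow_smul]
  refine Matrix.det_mem_pow _ fun k l => ?_
  rcases eq_or_ne k j with rfl | hk
  · rw [Matrix.updateRow_self, Pi.smul_apply, smul_eq_mul]
    exact I.mul_mem_right _ (hQI hq)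
  · rw [Matrix.updateRow_ne hk]
    exact hM _ _

theorem Ideal.span_pow_le {A : Type*} [CommRing A] {W : Set A} {n : ℕ} {N : Ideal A}
    (h : ∀ f : Fin n → A, (∀ i, f i ∈ W) → ∏ i, f i ∈ N) : span W ^ n ≤ N := by
  classical
  have := Submodule.span_pow (R := A) W n
  rw [Ideal.span, this, Submodule.span_le]
  intro y hy
  obtain ⟨f, rfl⟩ := Set.mem_pow.mp hy
  rw [List.prod_ofFn]
  exact h _ fun i => (f i).2

/-- If `Q ⊆ I ⊆ J`, `I * J ⊆ Q * J` and `J` is generated by `n` elements modulo `Q`, then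
`I ^ (n + 1) ⊆ Q * I ^ n`. -/
theorem Ideal.pow_succ_le_mul_pow_of_mul_le {A : Type*} [CommRing A] {Q I J : Ideal A}
    (hQI : Q ≤ I) (hIJ : I ≤ J) (h : I * J ≤ Q * J) (s : Finset A)
    (hs : J = Q + Ideal.span (↑s : Set A)) : I ^ (s.card + 1) ≤ Q * I ^ s.card := by
  classical
  have hsJ : ∀ t : s, (t : A) ∈ J := fun t => by
    rw [hs]; exact Ideal.mem_sup_right (Ideal.subset_span t.2)
  have hspan : ∀ y ∈ Ideal.span (↑s : Set A), ∃ c : s → A, y = ∑ t, c t * t := by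
    intro y hy
    obtain ⟨c, hc⟩ := Submodule.mem_span_finset'.mp hy
    exact ⟨c, by simpa using hc.symm⟩
  have hQspan : ∀ y ∈ Q * Ideal.span (↑s : Set A),
      ∃ c : s → A, (∀ t, c t ∈ Q) ∧ y = ∑ t, c t * t := by
    intro y hy
    refine Submodule.mul_induction_on hy ?_ ?_
    · intro q hq y hy
      obtain ⟨c, rfl⟩ := hspan y hy
      exact ⟨fun t => q * c t, fun t => Q.mul_mem_right _ hq, by
        rw [Finset.mul_sum]; exact Finset.sum_congr rfl fun _ _ => by ring⟩
    · rintro _ _ ⟨c, hc, rfl⟩ ⟨d, hd, rfl⟩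
      exact ⟨c + d, fun t => add_mem (hc t) (hd t), by
        simp [add_mul, Finset.sum_add_distrib]⟩
  have hprod : ∀ x : s → A, (∀ t, x t ∈ I) → ∀ v ∈ I, (∏ t, x t) * v ∈ Q * I ^ s.card := by
    intro x hx v hv
    have hrow : ∀ t : s, ∃ r ∈ Q * Q, ∃ c : s → A, (∀ t, c t ∈ Q) ∧
        x t * t = r + ∑ j, c j * j := by
      intro t
      have := h (Ideal.mul_mem_mul (hx t) (hsJ t))
      rw [hs, Ideal.add_eq_sup, Ideal.mul_sup] at this
      obtain ⟨r, hr, y, hy, hry⟩ := Submodule.mem_sup.mp this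
      obtain ⟨c, hc, rfl⟩ := hQspan y hy
      exact ⟨r, hr, c, hc, hry.symm⟩
    choose r hr c hc hrc using hrow
    set X : Matrix s s A := Matrix.diagonal x
    set D : Matrix s s A := X - Matrix.of c
    have hX : ∀ i j, X i j ∈ I := fun i j => by
      rcases eq_or_ne i j with rfl | hij
      · simpa [X] using hx i
      · simp [X, hij]
    have hD : ∀ i j, D i j ∈ I := fun i j => sub_mem (hX i j) (hQI (hc i j))
    have hcard : Fintype.card s = s.card := Fintype.card_coe s
    have hDs : D.mulVec (fun t : s => (t : A)) = r := by
      ext t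
      have h1 := hrc t
      simp only [D, Matrix.sub_mulVec, Pi.sub_apply, X, Matrix.mulVec_diagonal]
      rw [h1]
      simp [Matrix.mulVec, dotProduct]
    have hdets : ∀ t : s, D.det * t ∈ Q * I ^ s.card := by
      intro t
      have h1 : D.det * (t : A) = ∑ j, D.adjugate t j * r j := by
        have := congrFun (congrArg (fun M => Matrix.mulVec M (fun t : s => (t : A)))
          D.adjugate_mul) t
        rw [← Matrix.mulVec_mulVec, hDs] at this
        rw [Matrix.smul_mulVec, Matrix.one_mulVec] at this
        exact this.symm
      rw [h1]
      refine Ideal.sum_mem _ fun j _ => ?_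
      refine Submodule.mul_induction_on (hr j) ?_ ?_
      · intro q hq q' hq'
        have := Ideal.mul_mem_mul hq (D.mul_adjugate_mem hQI hD hq' t j)
        rw [hcard] at this
        convert this using 1
        ring
      · intro y z hy hz
        rw [mul_add]
        exact add_mem hy hz
    have hdet : D.det * v ∈ Q * I ^ s.card := by
      have hvJ := hIJ hv
      rw [hs] at hvJ
      obtain ⟨q, hq, y, hy, rfl⟩ := Submodule.mem_sup.mp hvJ
      obtain ⟨d, rfl⟩ := hspan y hy
      rw [mul_add, Finset.mul_sum]
      refine add_mem ?_ (Ideal.sum_mem _ fun t _ => ?_)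
      · rw [mul_comm D.det, ← hcard]
        exact Ideal.mul_mem_mul hq (D.det_mem_pow hD)
      · rw [mul_left_comm]
        exact Ideal.mul_mem_left _ _ (hdets t)
    have hdiff := Matrix.mul_det_sub_det_mem hQI D X hX
      (fun i j => by simpa [D] using hc i j) hv
    rw [hcard, Matrix.det_diagonal] at hdiff
    convert sub_mem hdet hdiff using 1
    ring
  rw [pow_succ, Ideal.mul_le]
  intro y hy v hv
  have hle : Ideal.span (I : Set A) ^ s.card ≤ (Q * I ^ s.card).colon {v} := by
    refine Ideal.span_pow_le fun f hf => Submodule.mem_colon_singleton.mpr ?_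
    have := hprod (f ∘ s.equivFin) (fun t => hf _) v hv
    rwa [← Equiv.prod_comp s.equivFin f]
  rw [Ideal.span_eq] at hle
  exact Submodule.mem_colon_singleton.mp (hle hy)

theorem Ideal.mem_span_singleton_mul_sup_span_singleton {S : Type*} [CommRing S] {a y x : S}
    {I : Ideal S} :
    x ∈ span {a} * I ⊔ span {y} ↔ ∃ α ∈ I, ∃ β, x = a * α + y * β := by
  simp only [Submodule.mem_sup, mem_span_singleton_mul, mem_span_singleton',
    exists_exists_and_eq_and, exists_exists_eq_and]
  exact ⟨fun ⟨α, h, β, e⟩ => ⟨α, h, β, by rw [← e]; ring⟩,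
    fun ⟨α, h, β, e⟩ => ⟨α, h, β, by rw [e]; ring⟩⟩

theorem List.prod_mul_eq_zero {S : Type*} [CommRing S] {ws : List S}
    (hreg : ∀ w ∈ ws, ∀ u, w * u = 0 → u = 0) (u : S) (hu : ws.prod * u = 0) : u = 0 := by
  induction ws generalizing u with
  | nil => simpa using hu
  | cons x ws ih =>
    rw [List.prod_cons, mul_assoc] at hu
    exact ih (fun w hw => hreg w (List.mem_cons_of_mem _ hw)) u (hreg x List.mem_cons_self _ hu)

theorem List.prod_dvd_of_dvd_mul {S : Type*} [CommRing S] {a : S} {ws : List S}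
    (hreg : ∀ w ∈ ws, ∀ u, w * u = 0 → u = 0) (hareg : ∀ w ∈ ws, ∀ u, w ∣ a * u → w ∣ u)
    (u : S) (hu : ws.prod ∣ a * u) : ws.prod ∣ u := by
  induction ws generalizing u with
  | nil => simp
  | cons x ws ih =>
    rw [List.prod_cons] at hu ⊢
    obtain ⟨v, hv⟩ := hu
    obtain ⟨u', rfl⟩ := hareg x List.mem_cons_self u ⟨_, by rw [hv, mul_assoc]⟩
    refine mul_dvd_mul_left _ (ih (fun w hw => hreg w (List.mem_cons_of_mem _ hw))
      (fun w hw => hareg w (List.mem_cons_of_mem _ hw)) u' ⟨v, ?_⟩)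
    rw [← sub_eq_zero]
    refine hreg x List.mem_cons_self _ ?_
    linear_combination hv

theorem List.prod_mem_pow {S : Type*} [CommRing S] {m : Ideal S} {ws : List S}
    (hm : ∀ w ∈ ws, w ∈ m) : ws.prod ∈ m ^ ws.length := by
  induction ws with
  | nil => simp
  | cons x ws ih =>
    rw [List.prod_cons, List.length_cons, pow_succ']
    exact Ideal.mul_mem_mul (hm x List.mem_cons_self)
      (ih fun w hw => hm w (List.mem_cons_of_mem _ hw))

/-- If `c` multiplies `m ^ s` into `(a, w₁ ⋯ wₛ)`, where `a, wᵢ` are regular sequences in `m`,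
then the coefficient of `a` may be chosen in `m ^ (s - e)`, provided the case `s = 1` holds in
the form of `hone`. -/
theorem mul_mem_of_mul_mem_span_sup_span_prod {S : Type*} [CommRing S] {m : Ideal S} {a c : S}
    {e : ℕ} (ws : List S)
    (hm : ∀ w ∈ ws, w ∈ m) (hreg : ∀ w ∈ ws, ∀ u, w * u = 0 → u = 0)
    (hareg : ∀ w ∈ ws, ∀ u, w ∣ a * u → w ∣ u)
    (hone : ∀ w ∈ ws, ∀ θ, (∀ v ∈ m, ∃ γ β, θ * v = a * γ + w * β) →
      ∀ v ∈ m, ∃ γ ∈ m ^ (1 - e), ∃ β, θ * v = a * γ + w * β)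
    (hc : ∀ z ∈ m ^ ws.length, ∃ α β, c * z = a * α + ws.prod * β) :
    ∀ z ∈ m ^ ws.length, ∃ α ∈ m ^ (ws.length - e), ∃ β, c * z = a * α + ws.prod * β := by
  induction ws with
  | nil => exact fun z _ => ⟨0, Ideal.zero_mem _, c * z, by simp⟩
  | cons w ws ih =>
    simp only [List.mem_cons, forall_eq_or_imp, List.length_cons, List.prod_cons]
      at hm hreg hareg hone hc ih ⊢
    have hprod := List.prod_mul_eq_zero (ws := ws) hreg.2
    have hprodreg := List.prod_dvd_of_dvd_mul (ws := ws) hreg.2 hareg.2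
    have hc' : ∀ z ∈ m ^ ws.length, ∃ α β, c * z = a * α + ws.prod * β := by
      intro z hz
      obtain ⟨α, β, h⟩ := hc (z * w) (by rw [pow_succ]; exact Ideal.mul_mem_mul hz hm.1)
      obtain ⟨α', rfl⟩ := hareg.1 α ⟨c * z - ws.prod * β, by linear_combination -h⟩
      refine ⟨α', β, ?_⟩
      rw [← sub_eq_zero]
      refine hreg.1 _ ?_
      linear_combination h
    have IH := ih hm.2 hreg.2 hareg.2 hone.2 hc'
    let N : Ideal S := Ideal.span {a} * m ^ (ws.length + 1 - e) ⊔ Ideal.span {w * ws.prod}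
    have hN : ∀ z, z ∈ N.colon {c} ↔
        ∃ α ∈ m ^ (ws.length + 1 - e), ∃ β, c * z = a * α + w * ws.prod * β := fun z => by
      rw [Submodule.mem_colon_singleton, smul_eq_mul, mul_comm,
        Ideal.mem_span_singleton_mul_sup_span_singleton]
    simp only [← hN]
    change m ^ (ws.length + 1) ≤ N.colon {c}
    rw [pow_succ, Ideal.mul_le]
    intro z hz v hv
    rw [hN]
    obtain ⟨μ, hμ, θ, hθ⟩ := IH z hz
    have key : ∀ v ∈ m, ∃ γ β, θ * v = a * γ + w * β := by
      intro v hv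
      obtain ⟨α, β, h⟩ := hc (z * v) (by rw [pow_succ]; exact Ideal.mul_mem_mul hz hv)
      obtain ⟨γ, hγ⟩ := hprodreg (α - μ * v) ⟨θ * v - w * β, by linear_combination v * hθ - h⟩
      refine ⟨γ, β, ?_⟩
      rw [← sub_eq_zero]
      refine hprod _ ?_
      linear_combination h - v * hθ + a * hγ
    obtain ⟨γ, hγ, β, h⟩ := hone.1 θ key v hv
    refine ⟨μ * v + ws.prod * γ, add_mem ?_ ?_, β, by linear_combination v * hθ + ws.prod * h⟩
    · refine Ideal.pow_le_pow_right (show _ ≤ ws.length - e + 1 by omega) ?_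
      rw [pow_succ]
      exact Ideal.mul_mem_mul hμ hv
    · refine Ideal.pow_le_pow_right (show _ ≤ ws.length + (1 - e) by omega) ?_
      rw [pow_add]
      refine Ideal.mul_mem_mul ?_ hγ
      exact List.prod_mem_pow hm.2

/-- An ideal containing a non-zero-divisor on a finite module `M` over a Noetherian ring is
generated by the non-zero-divisors on `M` it contains. -/
theorem Ideal.le_span_isSMulRegular {S M : Type*} [CommRing S] [IsNoetherianRing S] [AddCommGroup M]
    [Module S M] [Module.Finite S M] {I : Ideal S} {b : S} (hb : b ∈ I) (hreg : IsSMulRegular M b) :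
    I ≤ span {w | w ∈ I ∧ IsSMulRegular M w} := by
  classical
  set W := {w | w ∈ I ∧ IsSMulRegular M w}
  have hfin := associatedPrimes.finite S M
  have hU := biUnion_associatedPrimes_eq_zero_divisors S M
  have hcov : (I : Set S) ⊆
      ⋃ P ∈ (↑(insert (span W) hfin.toFinset) : Set (Ideal S)), (P : Set S) := by
    intro w hw
    simp only [Finset.coe_insert, Set.Finite.coe_toFinset, Set.biUnion_insert, Set.mem_union]
    by_cases hwr : IsSMulRegular M w
    · exact Or.inl (subset_span ⟨hw, hwr⟩)
    · right
      rw [hU]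
      rw [isSMulRegular_iff_right_eq_zero_of_smul] at hwr
      push Not at hwr
      obtain ⟨x, h1, h2⟩ := hwr
      exact ⟨x, h2, h1⟩
  rw [Ideal.subset_union_prime (f := fun P : Ideal S => P) (span W) (span W)] at hcov
  · obtain ⟨P, hP, hIP⟩ := hcov
    rcases Finset.mem_insert.mp hP with rfl | hP
    · exact hIP
    · exfalso
      have : b ∈ ⋃ p ∈ associatedPrimes S M, (p : Set S) :=
        Set.mem_biUnion (by simpa using hP) (hIP hb)
      rw [hU] at this
      obtain ⟨x, hx, h⟩ := this
      exact hx (hreg.right_eq_zero_of_smul h)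
  · intro P hP h _
    have := (Finset.mem_insert.mp hP).resolve_left h
    exact IsAssociatedPrime.isPrime (hfin.mem_toFinset.mp this)

theorem IsLocalRing.mul_eq_zero_of_dvd_mul {S : Type*} [CommRing S] [IsNoetherianRing S]
    [IsLocalRing S] {a w : S} (ham : a ∈ maximalIdeal S) (ha : ∀ u, a * u = 0 → u = 0)
    (hw : ∀ u, a ∣ w * u → a ∣ u) (u : S) (hu : w * u = 0) : u = 0 := by
  have key : ∀ n : ℕ, ∃ v, u = a ^ n * v ∧ w * v = 0 := by
    intro n
    induction n with
    | zero => exact ⟨u, by simp, hu⟩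
    | succ n ih =>
      obtain ⟨v, rfl, hv⟩ := ih
      obtain ⟨v', rfl⟩ := hw v (by rw [hv]; exact dvd_zero a)
      exact ⟨v', by ring, ha _ (by rw [← hv]; ring)⟩
  have : u ∈ (⨅ n : ℕ, maximalIdeal S ^ n) := by
    rw [Submodule.mem_iInf]
    intro n
    obtain ⟨v, rfl, -⟩ := key n
    exact Ideal.mul_mem_right _ _ (Ideal.pow_mem_pow ham n)
  rw [Ideal.iInf_pow_eq_bot_of_isLocalRing _ (maximalIdeal.isMaximal S).ne_top] at this
  exact this

/-- If `a, b` is a regular sequence in `m ^ t` and `f * m ^ t ⊆ (a, b)`, then the coefficient of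
`b` in every element of `f * m ^ t` lies in `m ^ t`, provided `a ∈ m ^ (t + e)` and `hone`. -/
theorem IsLocalRing.mem_pow_of_mul_eq_add_mul {S : Type*} [CommRing S] [IsNoetherianRing S]
    [IsLocalRing S] {t e : ℕ} (het : e ≤ t) (ht : t ≠ 0) {a b f : S}
    (ham : a ∈ maximalIdeal S ^ (t + e)) (hbm : b ∈ maximalIdeal S ^ t)
    (ha : ∀ u, a * u = 0 → u = 0) (hb : ∀ u, a ∣ b * u → a ∣ u)
    (hone : ∀ w ∈ maximalIdeal S, (∀ u, w ∣ a * u → w ∣ u) → ∀ θ,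
      (∀ v ∈ maximalIdeal S, ∃ γ β, θ * v = a * γ + w * β) →
      ∀ v ∈ maximalIdeal S, ∃ γ ∈ maximalIdeal S ^ (1 - e), ∃ β, θ * v = a * γ + w * β)
    (hf : ∀ y ∈ maximalIdeal S ^ t, ∃ d₁ d₂, f * y = a * d₁ + b * d₂)
    {y d₁ d₂ : S} (hy : y ∈ maximalIdeal S ^ t) (hd : f * y = a * d₁ + b * d₂) :
    d₂ ∈ maximalIdeal S ^ t := by
  set m := maximalIdeal S
  have hmt : m ^ t ≤ m := Ideal.pow_le_self ht
  have hmte : m ^ (t + e) ≤ m ^ t := Ideal.pow_le_pow_right (Nat.le_add_right t e)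
  set W := {w | w ∈ m ∧ IsSMulRegular (S ⧸ Ideal.span {a}) w}
  have hiff : ∀ w, IsSMulRegular (S ⧸ Ideal.span {a}) w ↔ ∀ u, a ∣ w * u → a ∣ u := by
    intro w
    rw [isSMulRegular_iff_right_eq_zero_of_smul, Ideal.Quotient.mk_surjective.forall]
    simp only [← Ideal.mem_span_singleton, ← Ideal.Quotient.eq_zero_iff_mem, map_mul,
      Algebra.smul_def, Ideal.Quotient.algebraMap_eq]
  have hW : m ≤ Ideal.span W := Ideal.le_span_isSMulRegular (hmt hbm) ((hiff b).mpr hb)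
  let N : Ideal S := Ideal.span {b} * m ^ t ⊔ Ideal.span {a}
  have hN : ∀ z, z ∈ N.colon {f} ↔ ∃ α ∈ m ^ t, ∃ β, f * z = b * α + a * β := fun z => by
    rw [Submodule.mem_colon_singleton, smul_eq_mul, mul_comm,
      Ideal.mem_span_singleton_mul_sup_span_singleton]
  have hle : m ^ t ≤ N.colon {f} := by
    refine (Ideal.pow_right_mono hW t).trans (Ideal.span_pow_le fun g hg => ?_)
    have hgm : ∀ w ∈ List.ofFn g, w ∈ m := List.forall_mem_ofFn_iff.mpr fun i => (hg i).1
    have hga : ∀ w ∈ List.ofFn g, ∀ u, a ∣ w * u → a ∣ u :=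
      List.forall_mem_ofFn_iff.mpr fun i => (hiff _).mp (hg i).2
    have hg0 : ∀ w ∈ List.ofFn g, ∀ u, w * u = 0 → u = 0 := fun w hw =>
      IsLocalRing.mul_eq_zero_of_dvd_mul (hmt (hmte ham)) ha (hga w hw)
    have hag : ∀ w ∈ List.ofFn g, ∀ u, w ∣ a * u → w ∣ u := by
      rintro w hw u ⟨v, hv⟩
      obtain ⟨v', rfl⟩ := hga w hw v ⟨u, hv.symm⟩
      refine ⟨v', ?_⟩
      rw [← sub_eq_zero]
      refine ha _ ?_
      linear_combination hv
    have hlen : (List.ofFn g).length = t := List.length_ofFn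
    have hprodm := List.prod_mem_pow hgm
    rw [hlen] at hprodm
    rw [← List.prod_ofFn, hN]
    set P := (List.ofFn g).prod
    obtain ⟨d, c, hdc⟩ := hf P hprodm
    refine ⟨c, ?_, d, by rw [hdc, add_comm]⟩
    have hc := mul_mem_of_mul_mem_span_sup_span_prod (e := e) (c := c) (List.ofFn g) hgm hg0 hag
      (fun w hw => hone w (hgm w hw) (hag w hw)) (by
        intro z hz
        rw [hlen] at hz
        obtain ⟨α₁, α₂, hα⟩ := hf z hz
        obtain ⟨α, h⟩ := hb (c * z - P * α₂) ⟨P * α₁ - d * z, by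
          linear_combination P * hα - z * hdc⟩
        exact ⟨α, α₂, by linear_combination h⟩)
    rw [hlen] at hc
    let N' : Ideal S := Ideal.span {a} * m ^ t ⊔ Ideal.span {P}
    have hN' : ∀ z, z ∈ N'.colon {c} ↔ ∃ α ∈ m ^ t, ∃ β, c * z = a * α + P * β := fun z => by
      rw [Submodule.mem_colon_singleton, smul_eq_mul, mul_comm,
        Ideal.mem_span_singleton_mul_sup_span_singleton]
    have hle' : m ^ (t + e) ≤ N'.colon {c} := by
      rw [pow_add, Ideal.mul_le]
      intro z hz v hv
      obtain ⟨α, hα, β, h⟩ := hc z hz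
      rw [hN']
      refine ⟨α * v, ?_, β * v, by linear_combination v * h⟩
      have := Ideal.mul_mem_mul hα hv
      rwa [← pow_add, Nat.sub_add_cancel het] at this
    obtain ⟨α, hα, β, h⟩ := (hN' a).mp (hle' ham)
    obtain ⟨v, hv⟩ := List.prod_dvd_of_dvd_mul hg0 hag (c - α) ⟨β, by linear_combination h⟩
    rw [eq_add_of_sub_eq hv]
    exact add_mem (Ideal.mul_mem_right _ _ hprodm) hα
  obtain ⟨α, hα, β, h⟩ := (hN y).mp (hle hy)
  obtain ⟨v, hv⟩ := hb (d₂ - α) ⟨β - d₁, by linear_combination h - hd⟩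
  rw [eq_add_of_sub_eq hv]
  exact add_mem (Ideal.mul_mem_right _ _ (hmte ham)) hα

/-- If the maximal ideal is not generated by two elements, `w, a` is a regular sequence and
`θ * m ⊆ (a, w)`, then `θ * m ⊆ (a * m, w)`. -/
theorem IsLocalRing.exists_mem_maximalIdeal_of_ne_span_pair {S : Type*} [CommRing S]
    [IsLocalRing S] (hm : ∀ w w' : S, maximalIdeal S ≠ Ideal.span {w, w'}) {a w : S}
    (hwm : w ∈ maximalIdeal S) (hw : ∀ u, w ∣ a * u → w ∣ u) {θ : S}
    (hθ : ∀ v ∈ maximalIdeal S, ∃ γ β, θ * v = a * γ + w * β) {v : S}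
    (hv : v ∈ maximalIdeal S) : ∃ γ ∈ maximalIdeal S, ∃ β, θ * v = a * γ + w * β := by
  obtain ⟨γ, β, h⟩ := hθ v hv
  refine ⟨γ, ?_, β, h⟩
  rw [mem_maximalIdeal, mem_nonunits_iff]
  intro hγ
  obtain ⟨δ, hδ⟩ := hγ.exists_right_inv
  refine hm w v (le_antisymm (fun x hx => ?_) ?_)
  · obtain ⟨γ', β', h'⟩ := hθ x hx
    have h1 : w ∣ θ * (x - γ' * δ * v) :=
      ⟨β' - γ' * δ * β, by linear_combination h' - γ' * δ * h - a * γ' * hδ⟩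
    obtain ⟨s, hs⟩ := h1
    obtain ⟨r, hr⟩ := hw (x - γ' * δ * v) ⟨δ * (v * s - β * (x - γ' * δ * v)), by
      linear_combination δ * v * hs - δ * (x - γ' * δ * v) * h - a * (x - γ' * δ * v) * hδ⟩
    exact Ideal.mem_span_pair.mpr ⟨r, γ' * δ, by linear_combination -hr⟩
  · rw [Ideal.span_le]
    rintro x (rfl | rfl)
    exacts [hwm, hv]

theorem IsLocalRing.mem_pow_of_mul_eq_add_mul' {S : Type*} [CommRing S] [IsNoetherianRing S]
    [IsLocalRing S] {t : ℕ} (ht : t ≠ 0) {a b f : S}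
    (h : (∀ w w' : S, maximalIdeal S ≠ Ideal.span {w, w'}) ∨ a ∈ maximalIdeal S ^ (t + 1))
    (ham : a ∈ maximalIdeal S ^ t) (hbm : b ∈ maximalIdeal S ^ t)
    (ha : ∀ u, a * u = 0 → u = 0) (hb : ∀ u, a ∣ b * u → a ∣ u)
    (hf : ∀ y ∈ maximalIdeal S ^ t, ∃ d₁ d₂, f * y = a * d₁ + b * d₂)
    {y d₁ d₂ : S} (hy : y ∈ maximalIdeal S ^ t) (hd : f * y = a * d₁ + b * d₂) :
    d₂ ∈ maximalIdeal S ^ t := by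
  rcases h with hm | ham'
  · refine mem_pow_of_mul_eq_add_mul (Nat.zero_le t) ht ham hbm ha hb ?_ hf hy hd
    intro w hw hwa θ hθ v hv
    simpa using exists_mem_maximalIdeal_of_ne_span_pair hm hw hwa hθ hv
  · refine mem_pow_of_mul_eq_add_mul (Nat.one_le_iff_ne_zero.mpr ht) ht ham' hbm ha hb ?_ hf hy hd
    intro w _ _ θ hθ v hv
    simpa using hθ v hv

theorem IsLocalRing.maximalIdeal_ne_span_pair_quotient {R : Type*} [CommRing R]
    [IsNoetherianRing R] [IsLocalRing R] {B : Ideal R} [IsLocalRing (R ⧸ B)]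
    (hB : B ≤ maximalIdeal R ^ 2) (hm : ∀ w w' : R, maximalIdeal R ≠ Ideal.span {w, w'})
    (w w' : R ⧸ B) : maximalIdeal (R ⧸ B) ≠ Ideal.span {w, w'} := by
  intro h
  obtain ⟨w, rfl⟩ := Ideal.Quotient.mk_surjective w
  obtain ⟨w', rfl⟩ := Ideal.Quotient.mk_surjective w'
  have hBm : B ≤ maximalIdeal R := hB.trans (Ideal.pow_le_self two_ne_zero)
  rw [← map_maximalIdeal_of_surjective (Ideal.Quotient.mk B) Ideal.Quotient.mk_surjective,
    ← Set.image_pair, ← Ideal.map_span] at h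
  refine hm w w' (le_antisymm ?_ ?_)
  · refine Submodule.le_of_le_smul_of_le_jacobson_bot (I := maximalIdeal R)
      (IsNoetherian.noetherian _) (maximalIdeal_le_jacobson ⊥) ?_
    intro x hx
    have hx' := (Ideal.mem_quotient_iff_mem_sup (I := B)).mp
      (h ▸ Ideal.mem_map_of_mem (Ideal.Quotient.mk B) hx)
    have hle : Ideal.span {w, w'} ⊔ B ≤ Ideal.span {w, w'} ⊔ maximalIdeal R • maximalIdeal R :=
      sup_le_sup_left (by rwa [smul_eq_mul, ← pow_two]) _
    exact hle hx'
  · intro x hx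
    exact (Ideal.mem_quotient_iff_mem hBm).mp (h ▸ Ideal.mem_map_of_mem (Ideal.Quotient.mk B) hx)

theorem IsLocalRing.mem_pow_of_mul_sub_mem {R : Type*} [CommRing R] [IsNoetherianRing R]
    [IsLocalRing R] {t : ℕ} (ht : 2 ≤ t) {B : Ideal R} (hB : B ≤ maximalIdeal R ^ t) {a b f : R}
    (h : (∀ w w' : R, maximalIdeal R ≠ Ideal.span {w, w'}) ∨ a ∈ maximalIdeal R ^ (t + 1))
    (ham : a ∈ maximalIdeal R ^ t) (hbm : b ∈ maximalIdeal R ^ t)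
    (ha : ∀ u, a * u ∈ B → u ∈ B) (hb : ∀ u, b * u ∈ B ⊔ Ideal.span {a} → u ∈ B ⊔ Ideal.span {a})
    (hf : ∀ y ∈ maximalIdeal R ^ t, ∃ d₁ d₂, f * y - (a * d₁ + b * d₂) ∈ B)
    {y d₁ d₂ : R} (hy : y ∈ maximalIdeal R ^ t) (hd : f * y - (a * d₁ + b * d₂) ∈ B) :
    d₂ ∈ maximalIdeal R ^ t := by
  have hBm : B ≤ maximalIdeal R := hB.trans (Ideal.pow_le_self (by omega))
  have : Nontrivial (R ⧸ B) := Ideal.Quotient.nontrivial_iff.mpr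
    (ne_top_of_le_ne_top (maximalIdeal.isMaximal R).ne_top hBm)
  have : IsLocalRing (R ⧸ B) :=
    .of_surjective' (Ideal.Quotient.mk B) Ideal.Quotient.mk_surjective
  have hmap : ∀ n, maximalIdeal (R ⧸ B) ^ n = (maximalIdeal R ^ n).map (Ideal.Quotient.mk B) := by
    intro n
    rw [Ideal.map_pow,
      map_maximalIdeal_of_surjective (Ideal.Quotient.mk B) Ideal.Quotient.mk_surjective]
  have hdvd : ∀ u, Ideal.Quotient.mk B a ∣ Ideal.Quotient.mk B u ↔ u ∈ B ⊔ Ideal.span {a} := by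
    intro u
    rw [← Ideal.mem_span_singleton, ← Set.image_singleton, ← Ideal.map_span,
      Ideal.mem_quotient_iff_mem_sup, sup_comm]
  rw [← Ideal.mem_quotient_iff_mem hB, ← hmap]
  refine mem_pow_of_mul_eq_add_mul' (a := Ideal.Quotient.mk B a) (b := Ideal.Quotient.mk B b)
    (f := Ideal.Quotient.mk B f) (y := Ideal.Quotient.mk B y) (d₁ := Ideal.Quotient.mk B d₁)
    (by omega) ?_ ?_ ?_ ?_ ?_ ?_ ?_ ?_
  · rcases h with h | h
    · exact .inl (maximalIdeal_ne_span_pair_quotient (hB.trans (Ideal.pow_le_pow_right ht)) h)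
    · exact .inr (hmap _ ▸ Ideal.mem_map_of_mem _ h)
  · exact hmap _ ▸ Ideal.mem_map_of_mem _ ham
  · exact hmap _ ▸ Ideal.mem_map_of_mem _ hbm
  · intro u hu
    obtain ⟨u, rfl⟩ := Ideal.Quotient.mk_surjective u
    rw [← map_mul, Ideal.Quotient.eq_zero_iff_mem] at hu
    exact Ideal.Quotient.eq_zero_iff_mem.mpr (ha u hu)
  · intro u hu
    obtain ⟨u, rfl⟩ := Ideal.Quotient.mk_surjective u
    rw [← map_mul, hdvd] at hu
    exact (hdvd u).mpr (hb u hu)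
  · intro y hy
    obtain ⟨y, rfl⟩ := Ideal.Quotient.mk_surjective y
    rw [hmap, Ideal.mem_quotient_iff_mem hB] at hy
    obtain ⟨d₁, d₂, hd⟩ := hf y hy
    refine ⟨Ideal.Quotient.mk B d₁, Ideal.Quotient.mk B d₂, ?_⟩
    simpa using Ideal.Quotient.mk_eq_mk_iff_sub_mem _ _ |>.mpr hd
  · exact hmap _ ▸ Ideal.mem_map_of_mem _ hy
  · simpa using Ideal.Quotient.mk_eq_mk_iff_sub_mem _ _ |>.mpr hd

theorem RingTheory.Sequence.IsWeaklyRegular.mem_ofList_of_mul_mem {R : Type*} [CommRing R]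
    {l l' : List R} {r : R} (h : IsWeaklyRegular R (l ++ r :: l')) {x : R}
    (hx : r * x ∈ Ideal.ofList l) : x ∈ Ideal.ofList l := by
  rw [isWeaklyRegular_append_iff, isWeaklyRegular_cons_iff,
    isSMulRegular_quotient_iff_mem_of_smul_mem] at h
  simpa using h.2.1 x (by simpa using hx)

theorem IsLocalRing.coeff_mem_pow_of_isWeaklyRegular {R : Type*} [CommRing R] [IsNoetherianRing R]
    [IsLocalRing R] {t g : ℕ} (ht : 2 ≤ t) (hg : 2 ≤ g) {a : Fin g → R}
    (hreg : RingTheory.Sequence.IsWeaklyRegular R (List.ofFn a))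
    (ha : ∀ i, a i ∈ maximalIdeal R ^ t)
    (h : (∀ w w' : R, maximalIdeal R ≠ Ideal.span {w, w'}) ∨ ∀ i, a i ∈ maximalIdeal R ^ (t + 1))
    {f : R} (hf : ∀ y ∈ maximalIdeal R ^ t, f * y ∈ Ideal.span (Set.range a)) {y : R}
    (hy : y ∈ maximalIdeal R ^ t) {d : Fin g → R} (hd : f * y = ∑ i, d i * a i) (i : Fin g) :
    d i ∈ maximalIdeal R ^ t := by
  have : Nontrivial (Fin g) := Fin.nontrivial_iff_two_le.mpr hg
  obtain ⟨i', hi'⟩ := exists_ne i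
  let l := (List.finRange g).filter fun j => j ≠ i ∧ j ≠ i'
  let B := Ideal.ofList (l.map a)
  have hl : ∀ j, j ∈ l ↔ j ≠ i ∧ j ≠ i' := by simp [l]
  have hperm : (List.finRange g).Perm (l ++ [i', i]) := by
    rw [List.perm_ext_iff_of_nodup (List.nodup_finRange g)]
    · intro j
      simp only [List.mem_finRange, List.mem_append, hl, List.mem_cons, List.not_mem_nil,
        or_false, true_iff]
      tauto
    · refine List.nodup_append.mpr ⟨(List.nodup_finRange g).filter _, by simpa using hi', ?_⟩
      rintro j hj j' hj' rfl
      simp only [hl, List.mem_cons, List.not_mem_nil, or_false] at hj hj'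
      tauto
  have hreg' := isWeaklyRegular_of_perm_of_subset_maximalIdeal (rs' := l.map a ++ [a i', a i])
    hreg (by simpa [List.ofFn_eq_map] using hperm.map a) (by
      intro r hr
      obtain ⟨j, rfl⟩ := (List.mem_ofFn' _ _).mp hr
      exact Ideal.pow_le_self (by omega) (ha j))
  have haB : ∀ j, j ≠ i → j ≠ i' → a j ∈ B := fun j hj hj' =>
    Ideal.subset_span (List.mem_map_of_mem ((hl j).mpr ⟨hj, hj'⟩))
  have hBle : B ≤ maximalIdeal R ^ t := by
    refine Ideal.span_le.mpr ?_
    intro r hr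
    obtain ⟨j, -, rfl⟩ := List.mem_map.mp hr
    exact ha j
  have hsum : ∀ c : Fin g → R, ∑ j, c j * a j - (a i' * c i' + a i * c i) ∈ B := by
    intro c
    rw [← Finset.add_sum_erase _ _ (Finset.mem_univ i),
      ← Finset.add_sum_erase _ _ (Finset.mem_erase.mpr ⟨hi', Finset.mem_univ i'⟩)]
    have : ∑ j ∈ (Finset.univ.erase i).erase i', c j * a j ∈ B := by
      refine Ideal.sum_mem _ fun j hj => B.mul_mem_left _ (haB j ?_ ?_)
      · exact (Finset.mem_erase.mp (Finset.mem_erase.mp hj).2).1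
      · exact (Finset.mem_erase.mp hj).1
    convert this using 1
    ring
  refine mem_pow_of_mul_sub_mem ht hBle (a := a i') (b := a i) (f := f) (y := y) (d₁ := d i')
    ?_ (ha i') (ha i) ?_ ?_ ?_ hy (hd ▸ hsum d)
  · exact h.imp_right fun h => h i'
  · intro u hu
    exact hreg'.mem_ofList_of_mul_mem hu
  · intro u hu
    have := RingTheory.Sequence.IsWeaklyRegular.mem_ofList_of_mul_mem (l := l.map a ++ [a i'])
      (r := a i) (l' := []) (x := u) (by simpa using hreg')
    simpa only [Ideal.ofList_append, Ideal.ofList_singleton, B] using this (by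
      simpa only [Ideal.ofList_append, Ideal.ofList_singleton, B] using hu)
  · intro z hz
    obtain ⟨c, hc⟩ := Ideal.mem_span_range_iff_exists_fun.mp (hf z hz)
    exact ⟨c i', c i, hc ▸ hsum c⟩

theorem Ideal.ofList_take_ofFn {A : Type*} [CommRing A] {n : ℕ} (a : Fin n → A) (i : Fin n) :
    Ideal.ofList ((List.ofFn a).take i) = Ideal.span (a '' {j | j < i}) := by
  refine congrArg Ideal.span (Set.ext fun x => ?_)
  simp only [Set.mem_ofPred_eq, List.mem_take_iff_getElem, List.getElem_ofFn, Set.mem_image]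
  constructor
  · rintro ⟨j, hj, rfl⟩
    exact ⟨⟨j, by omega⟩, Fin.lt_def.mpr (show j < i by omega), rfl⟩
  · rintro ⟨j, hj, rfl⟩
    exact ⟨j, by simpa using hj, rfl⟩

theorem IsRegularSeq.isWeaklyRegular {A : Type*} [CommRing A] {n : ℕ} {a : Fin n → A}
    (h : IsRegularSeq a) : RingTheory.Sequence.IsWeaklyRegular A (List.ofFn a) := by
  rw [RingTheory.Sequence.isWeaklyRegular_iff]
  intro i hi
  have hi' : i < n := by simpa using hi
  rw [isSMulRegular_quotient_iff_mem_of_smul_mem]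
  intro x hx
  have key := h.1 ⟨i, hi'⟩ x
  rw [← Ideal.ofList_take_ofFn] at key
  simpa using key (by simpa using hx)

theorem mem_span_range_of_sum_mul_eq_zero {A : Type*} [CommRing A] {n : ℕ} {a : Fin n → A}
    (h : ∀ i : Fin n, ∀ x : A,
      a i * x ∈ Ideal.span (a '' {j | j < i}) → x ∈ Ideal.span (a '' {j | j < i}))
    {c : Fin n → A} (hc : ∑ i, c i * a i = 0) (i : Fin n) : c i ∈ Ideal.span (Set.range a) := by
  induction n with
  | zero => exact i.elim0
  | succ n ih =>
    have himage : ∀ i : Fin n, a '' {j | j < i.castSucc} = (a ∘ Fin.castSucc) '' {j | j < i} := by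
      intro i
      ext x
      constructor
      · rintro ⟨j, hj, rfl⟩
        exact ⟨j.castPred (Fin.ne_last_of_lt hj), hj, by simp⟩
      · rintro ⟨j, hj, rfl⟩
        exact ⟨j.castSucc, by simpa using hj, rfl⟩
    have hlast : a '' {j | j < Fin.last n} = Set.range (a ∘ Fin.castSucc) := by
      ext x
      constructor
      · rintro ⟨j, hj, rfl⟩
        exact ⟨j.castPred (Fin.ne_last_of_lt hj), by simp⟩
      · rintro ⟨j, rfl⟩
        exact ⟨j.castSucc, Fin.castSucc_lt_last j, rfl⟩
    have hle : Ideal.span (Set.range (a ∘ Fin.castSucc)) ≤ Ideal.span (Set.range a) :=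
      Ideal.span_mono (Set.range_comp_subset_range _ _)
    rw [Fin.sum_univ_castSucc] at hc
    have hcl : c (Fin.last n) ∈ Ideal.span (Set.range (a ∘ Fin.castSucc)) := by
      have := h (Fin.last n) (c (Fin.last n))
      rw [hlast] at this
      refine this ?_
      rw [mul_comm, eq_neg_of_add_eq_zero_right hc]
      exact neg_mem (Ideal.sum_mem _ fun i _ =>
        Ideal.mul_mem_left _ _ (Ideal.subset_span ⟨i, rfl⟩))
    obtain ⟨e, he⟩ := Ideal.mem_span_range_iff_exists_fun.mp hcl
    have hrel : ∑ i : Fin n, (c i.castSucc + e i * a (Fin.last n)) * (a ∘ Fin.castSucc) i = 0 := by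
      rw [← hc, ← he, Finset.sum_mul, ← Finset.sum_add_distrib]
      exact Finset.sum_congr rfl fun i _ => by simp only [Function.comp_apply]; ring
    refine Fin.lastCases (hle hcl) (fun i => ?_) i
    have hi := hle (ih (fun i x => himage i ▸ h i.castSucc x) hrel i)
    have ha : a (Fin.last n) ∈ Ideal.span (Set.range a) := Ideal.subset_span ⟨_, rfl⟩
    exact (Ideal.add_mem_iff_left _ (Ideal.mul_mem_left _ (e i) ha)).mp hi

theorem symbolicPow_eq_comap {A : Type*} [CommRing A] (p : Ideal A) [p.IsPrime] (k : ℕ) :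
    symbolicPow p k = (IsLocalRing.maximalIdeal (Localization.AtPrime p) ^ k).comap
      (algebraMap A (Localization.AtPrime p)) := by
  rw [symbolicPow, Localization.AtPrime.map_eq_maximalIdeal]

theorem pow_le_symbolicPow {A : Type*} [CommRing A] (p : Ideal A) [p.IsPrime] (k : ℕ) :
    p ^ k ≤ symbolicPow p k := by
  rw [symbolicPow, ← Ideal.map_pow]
  exact Ideal.le_comap_map

/-- The localization at a prime of height `g ≥ 2` whose maximal ideal is generated by two elements
is regular of dimension two. -/
theorem isRegLocalRing_of_maximalIdeal_eq_span_pair {A : Type*} [CommRing A] [IsNoetherianRing A]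
    (p : Ideal A) [hp : p.IsPrime] {g : ℕ} (hg : 2 ≤ g)
    (hht : Order.height (⟨p, hp⟩ : PrimeSpectrum A) = (g : ℕ∞))
    {w w' : Localization.AtPrime p}
    (h : IsLocalRing.maximalIdeal (Localization.AtPrime p) = Ideal.span {w, w'}) :
    IsRegLocalRing (Localization.AtPrime p) ∧ g = 2 := by
  classical
  let R := Localization.AtPrime p
  have hN : IsNoetherianRing R := IsLocalization.isNoetherianRing p.primeCompl R inferInstance
  have hdim : ringKrullDim R = (g : WithBot ℕ∞) := by
    rw [IsLocalization.AtPrime.ringKrullDim_eq_height p R]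
    have := PrimeSpectrum.height_eq_orderHeight (⟨p, hp⟩ : PrimeSpectrum A)
    rw [hht] at this
    simp only at this
    rw [this]
    rfl
  have hspan : Ideal.span (↑({w, w'} : Finset R) : Set R) = IsLocalRing.maximalIdeal R :=
    (congrArg Ideal.span Finset.coe_pair).trans h.symm
  have hle : ringKrullDim R ≤ (({w, w'} : Finset R).card : WithBot ℕ∞) := by
    rw [← IsLocalRing.maximalIdeal_height_eq_ringKrullDim]
    have := Ideal.height_le_card_of_mem_minimalPrimes_span_finset (s := ({w, w'} : Finset R))
      (p := IsLocalRing.maximalIdeal R) (by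
        rw [hspan, Ideal.minimalPrimes_eq_subsingleton_self]
        rfl)
    exact_mod_cast this
  have hcard : ({w, w'} : Finset R).card ≤ 2 := Finset.card_le_two
  rw [hdim] at hle
  have hle' : g ≤ ({w, w'} : Finset R).card := by exact_mod_cast hle
  have hg2 : g = 2 := by omega
  refine ⟨⟨hN, inferInstance, {w, w'}, hspan, ?_⟩, hg2⟩
  rw [hdim]
  exact congrArg _ (by omega)

theorem Ideal.colon_mul_colon_le {A : Type*} [CommRing A] {n : ℕ} {a : Fin n → A} {P : Ideal A}
    (hrel : ∀ c : Fin n → A, ∑ i, c i * a i = 0 → ∀ i, c i ∈ span (Set.range a))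
    (hJP : (span (Set.range a)).colon P ≤ P)
    (hP : ∀ f ∈ (span (Set.range a)).colon P, ∀ y ∈ P, ∀ d : Fin n → A,
      f * y = ∑ i, d i * a i → ∀ i, d i ∈ P) :
    (span (Set.range a)).colon P * (span (Set.range a)).colon P ≤
      span (Set.range a) * (span (Set.range a)).colon P := by
  rw [mul_le]
  intro f hf h hh
  obtain ⟨c, hc⟩ := mem_span_range_iff_exists_fun.mp (Submodule.mem_colon.mp hf h (hJP hh))
  rw [smul_eq_mul] at hc
  rw [← hc]
  refine sum_mem _ fun i _ => ?_
  rw [mul_comm (c i)]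
  refine mul_mem_mul (subset_span ⟨i, rfl⟩) (Submodule.mem_colon.mpr fun y hy => ?_)
  obtain ⟨d, hd⟩ := mem_span_range_iff_exists_fun.mp (Submodule.mem_colon.mp hh y hy)
  rw [smul_eq_mul] at hd
  have hi := hrel (fun i => c i * y - f * d i) (by
    simp only [sub_mul, Finset.sum_sub_distrib, mul_assoc f, mul_right_comm _ y,
      ← Finset.sum_mul, ← Finset.mul_sum, hc, hd]
    ring) i
  have hfd : f * d i ∈ span (Set.range a) :=
    Submodule.mem_colon.mp hf _ (hP h hh y hy d hd.symm i)
  simpa using add_mem hi hfd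

theorem coeff_mem_symbolicPow {A : Type*} [CommRing A] [IsNoetherianRing A] (p : Ideal A)
    [hp : p.IsPrime] {g : ℕ} (hg : 2 ≤ g)
    (hht : Order.height (⟨p, hp⟩ : PrimeSpectrum A) = (g : ℕ∞)) {k : ℕ} (hk : 2 ≤ k)
    {a : Fin g → A} (hreg : IsRegularSeq a) (ha : ∀ i, a i ∈ symbolicPow p k)
    (hcond : (¬ IsRegLocalRing (Localization.AtPrime p)) ∨
      (IsRegLocalRing (Localization.AtPrime p) ∧ 3 ≤ g) ∨
      (IsRegLocalRing (Localization.AtPrime p) ∧ g = 2 ∧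
        ∀ i, a i ∈ symbolicPow p (k + 1)))
    {f : A} (hf : f ∈ (Ideal.span (Set.range a)).colon (symbolicPow p k)) {y : A}
    (hy : y ∈ symbolicPow p k) {d : Fin g → A} (hd : f * y = ∑ i, d i * a i) (i : Fin g) :
    d i ∈ symbolicPow p k := by
  let R := Localization.AtPrime p
  let φ := algebraMap A R
  have hN : IsNoetherianRing R := IsLocalization.isNoetherianRing p.primeCompl R inferInstance
  simp only [symbolicPow_eq_comap, Ideal.mem_comap] at ha hy ⊢
  have hreg' : RingTheory.Sequence.IsWeaklyRegular R (List.ofFn (φ ∘ a)) := by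
    rw [← List.map_ofFn]
    exact hreg.isWeaklyRegular.of_isLocalization R p.primeCompl
  refine IsLocalRing.coeff_mem_pow_of_isWeaklyRegular hk hg hreg' ha ?_ (f := φ f) ?_ hy
    (d := φ ∘ d) ?_ i
  · by_cases hm : ∀ w w' : R, IsLocalRing.maximalIdeal R ≠ Ideal.span {w, w'}
    · exact .inl hm
    · push Not at hm
      obtain ⟨w, w', hm⟩ := hm
      obtain ⟨hR, hg2⟩ := isRegLocalRing_of_maximalIdeal_eq_span_pair p hg hht hm
      rcases hcond with h | h | h
      · exact absurd hR h
      · omega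
      · refine .inr fun i => ?_
        have := h.2.2 i
        rwa [symbolicPow_eq_comap] at this
  · have hle : p ^ k ≤ (Ideal.span (Set.range a)).colon {f} := by
      intro z hz
      rw [Submodule.mem_colon_singleton, smul_eq_mul, mul_comm]
      exact Submodule.mem_colon.mp hf z (pow_le_symbolicPow p k hz)
    have hle' : IsLocalRing.maximalIdeal R ^ k ≤
        (Ideal.span (Set.range (φ ∘ a))).colon {φ f} := by
      rw [← Localization.AtPrime.map_eq_maximalIdeal, ← Ideal.map_pow, Ideal.map_le_iff_le_comap]
      intro z hz
      have hz' := Submodule.mem_colon_singleton.mp (hle hz)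
      rw [Ideal.mem_comap, Submodule.mem_colon_singleton, smul_eq_mul, Set.range_comp,
        ← Ideal.map_span]
      rw [smul_eq_mul] at hz'
      simpa using Ideal.mem_map_of_mem φ hz'
    intro z hz
    rw [mul_comm]
    exact Submodule.mem_colon_singleton.mp (hle' hz)
  · simpa using congrArg φ hd

/-- **Corollary 3.3.**  Let `A` be Noetherian, `p` a prime of height `g ≥ 2`, `k ≥ 2`,
and `Q = (a 0, …, a (g-1))` generated by a regular sequence contained in the
symbolic power `p^{(k)}`.  Assume (i) `A_p` is not regular, or (ii) `A_p` is regular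
and `g ≥ 3`, or (iii) `A_p` is regular, `g = 2` and each `a i ∈ p^{(k+1)}`.  Then for
every ideal `I` with `Q ⊆ I ⊆ (Q : p^{(k)})` one has
`r_Q(I) ≤ μ_A((Q : p^{(k)})/Q) + 1`. -/
theorem reduction_number_le_of_symbolic_power {A : Type*} [CommRing A]
    [IsNoetherianRing A] (p : Ideal A) [hp : p.IsPrime] (g : ℕ) (hg : 2 ≤ g)
    (hht : Order.height (⟨p, hp⟩ : PrimeSpectrum A) = (g : ℕ∞))
    (k : ℕ) (hk : 2 ≤ k)
    (a : Fin g → A) (hreg : IsRegularSeq a) (ha : ∀ i, a i ∈ symbolicPow p k)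
    (Q : Ideal A) (hQ : Q = Ideal.span (Set.range a))
    (hcond : (¬ IsRegLocalRing (Localization.AtPrime p)) ∨
      (IsRegLocalRing (Localization.AtPrime p) ∧ 3 ≤ g) ∨
      (IsRegLocalRing (Localization.AtPrime p) ∧ g = 2 ∧
        ∀ i, a i ∈ symbolicPow p (k + 1)))
    (I : Ideal A) (hQI : Q ≤ I) (hIc : I ≤ Q.colon (symbolicPow p k)) :
    redNum Q I ≤
      ((sInf {m : ℕ | ∃ s : Finset A, s.card = m ∧
        Q.colon (symbolicPow p k) = Q + Ideal.span (↑s : Set A)} + 1 : ℕ) : ℕ∞) := by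
  classical
  subst hQ
  have hd : ∀ f ∈ (Ideal.span (Set.range a)).colon (symbolicPow p k), ∀ y ∈ symbolicPow p k,
      ∀ d : Fin g → A, f * y = ∑ i, d i * a i → ∀ i, d i ∈ symbolicPow p k :=
    fun f hf y hy d h => coeff_mem_symbolicPow p hg hht hk hreg ha hcond hf hy h
  have hJP : (Ideal.span (Set.range a)).colon (symbolicPow p k) ≤ symbolicPow p k := by
    intro f hf
    let j : Fin g := ⟨0, by omega⟩
    simpa using hd f hf (a j) (ha j) (Pi.single j f) (by simp [Pi.single_apply]) j
  have hJJ := Ideal.colon_mul_colon_le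
    (fun c hc i => mem_span_range_of_sum_mul_eq_zero hreg.1 hc i) hJP hd
  have hIJ := (Ideal.mul_mono_left hIc).trans hJJ
  have hne : {m : ℕ | ∃ s : Finset A, s.card = m ∧
      (Ideal.span (Set.range a)).colon (symbolicPow p k) =
        Ideal.span (Set.range a) + Ideal.span (↑s : Set A)}.Nonempty := by
    obtain ⟨s, hs⟩ := IsNoetherian.noetherian
      ((Ideal.span (Set.range a)).colon (symbolicPow p k) : Ideal A)
    refine ⟨s.card, s, rfl, ?_⟩
    exact (sup_eq_right.mpr (hQI.trans hIc)).symm.trans (congrArg _ hs.symm)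
  obtain ⟨s, hcard, hs⟩ := Nat.sInf_mem hne
  have hle := Ideal.pow_succ_le_mul_pow_of_mul_le hQI hIc hIJ s hs
  rw [← hcard]
  have hred : redNum (Ideal.span (Set.range a)) I ≤ (s.card : ℕ∞) :=
    sInf_le ⟨s.card, rfl, le_antisymm hle ((Ideal.mul_mono_left hQI).trans_eq (pow_succ' I _).symm)⟩
  exact hred.trans (by exact_mod_cast Nat.le_succ _)
end

section
/- Let (A, 𝔪) be a two-dimensional Cohen–Macaulay Noetherian local ring with infinite residue field, let I be an 𝔪-primary ideal of A with a minimal reduction Q, and let J be any ideal with I ⊆ J ⊆ Ī (the integral closure of I). Then r_Q(I) ≤ e_1(J) − e_0(J) + ℓ_A(A/I) + 1, where e_0(J) and e_1(J) are the first two Hilbert coefficients of J. -/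
open IsLocalRing

/-- `Q` is a reduction of `I`. -/
def IsReduction {A : Type*} [CommRing A] (Q I : Ideal A) : Prop :=
  Q ≤ I ∧ ∃ n : ℕ, I ^ (n + 1) = Q * I ^ n

/-- `Q` is a minimal reduction of `I`. -/
def IsMinimalReduction {A : Type*} [CommRing A] (Q I : Ideal A) : Prop :=
  IsReduction Q I ∧ ∀ Q' : Ideal A, Q' ≤ Q → IsReduction Q' I → Q' = Q

/-- The integral closure of an ideal `I`. -/
def idealIC {A : Type*} [CommRing A] (I : Ideal A) : Set A :=
  {x | ∃ m : ℕ, 0 < m ∧ ∃ c : ℕ → A, (∀ i ∈ Finset.Icc 1 m, c i ∈ I ^ i) ∧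
    x ^ m + ∑ i ∈ Finset.Icc 1 m, c i * x ^ (m - i) = 0}

/-- The length of an `A`-module `M`: the Krull dimension of its lattice of
submodules. -/
noncomputable def modLength (A : Type*) [CommRing A] (M : Type*) [AddCommGroup M]
    [Module A M] : WithBot ℕ∞ :=
  Order.krullDim (Submodule A M)

section Colength

variable {A : Type*} [CommRing A]

/-- The colength `ℓ_A(A/E)` of an ideal. -/
noncomputable def colength (E : Ideal A) : ℕ∞ := Module.length A (A ⧸ E)

lemma length_eq_range_add_quotient {M N : Type*} [AddCommGroup M] [Module A M] [AddCommGroup N]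
    [Module A N] (f : M →ₗ[A] N) :
    Module.length A N = Module.length A (LinearMap.range f) +
      Module.length A (N ⧸ LinearMap.range f) :=
  Module.length_eq_add_of_exact (LinearMap.range f).subtype (LinearMap.range f).mkQ
    (Submodule.subtype_injective _) (Submodule.mkQ_surjective _)
    (LinearMap.exact_subtype_mkQ _)

lemma length_eq_ker_add_range {M N : Type*} [AddCommGroup M] [Module A M] [AddCommGroup N]
    [Module A N] (f : M →ₗ[A] N) :
    Module.length A M = Module.length A (LinearMap.ker f) + Module.length A (LinearMap.range f) :=
  Module.length_eq_add_of_exact (LinearMap.ker f).subtype f.rangeRestrict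
    (Submodule.subtype_injective _) f.surjective_rangeRestrict
    (fun x => by simp [Subtype.ext_iff])

lemma colength_eq_add_of_le {D D' : Ideal A} (h : D ≤ D') :
    colength D = colength D' + Module.length A (Submodule.map D.mkQ D') := by
  have h1 := length_eq_range_add_quotient (Submodule.map D.mkQ D').subtype
  rw [Submodule.range_subtype,
    (Submodule.quotientQuotientEquivQuotient D D' h).length_eq] at h1
  rw [colength, h1, add_comm]; rfl

lemma colength_antitone {D D' : Ideal A} (h : D ≤ D') : colength D' ≤ colength D := by
  rw [colength_eq_add_of_le h]; exact le_self_add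

lemma eq_of_le_of_colength_le {D D' : Ideal A} (h : D ≤ D') (hfin : colength D' ≠ ⊤)
    (hc : colength D ≤ colength D') : D = D' := by
  rw [colength_eq_add_of_le h] at hc
  have h0 : Module.length A (Submodule.map D.mkQ D') = 0 := by
    exact le_zero_iff.1 ((ENat.add_le_add_iff_left hfin).1 (by simpa [add_comm] using hc))
  rw [Module.length_eq_zero_iff, Submodule.subsingleton_iff_eq_bot] at h0
  refine le_antisymm h fun x hx => ?_
  have : D.mkQ x ∈ Submodule.map D.mkQ D' := Submodule.mem_map_of_mem hx
  rw [h0, Submodule.mem_bot] at this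
  exact (Submodule.Quotient.mk_eq_zero D).1 this

lemma colength_top : colength (⊤ : Ideal A) = 0 :=
  Module.length_eq_zero_iff.2 (Ideal.Quotient.subsingleton_iff.2 rfl)

/-- Multiplication by `y` identifies `F/E` with `(D + yF)/D` when `E` is the preimage of `D`. -/
lemma colength_add_colength_of_mul {D E F : Ideal A} (y : A) (hEF : E ≤ F)
    (hE : ∀ z ∈ F, z ∈ E ↔ y * z ∈ D) :
    colength D + colength F = colength (D ⊔ Ideal.span {y} * F) + colength E := by
  let f : F →ₗ[A] (A ⧸ E) := E.mkQ ∘ₗ F.subtype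
  let g : F →ₗ[A] (A ⧸ D) := D.mkQ ∘ₗ (LinearMap.mulLeft A y) ∘ₗ F.subtype
  have hker : LinearMap.ker f = LinearMap.ker g := by
    ext ⟨z, hz⟩
    simp only [LinearMap.mem_ker, f, g, LinearMap.comp_apply, Submodule.subtype_apply,
      Submodule.mkQ_apply, Submodule.Quotient.mk_eq_zero, LinearMap.mulLeft_apply, hE z hz]
  have e : LinearMap.range f ≃ₗ[A] LinearMap.range g :=
    f.quotKerEquivRange.symm ≪≫ₗ Submodule.quotEquivOfEq _ _ hker ≪≫ₗ g.quotKerEquivRange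
  have hf : LinearMap.range f = Submodule.map E.mkQ F := by
    rw [LinearMap.range_comp, Submodule.range_subtype]
  have hg : LinearMap.range g = Submodule.map D.mkQ (D ⊔ Ideal.span {y} * F) := by
    rw [LinearMap.range_comp, LinearMap.range_comp, Submodule.range_subtype, Submodule.map_sup,
      Submodule.mkQ_map_self, bot_sup_eq]
    congr 1
    ext z
    simp [Ideal.mem_span_singleton_mul]
  rw [colength_eq_add_of_le hEF, colength_eq_add_of_le (le_sup_left : D ≤ _), ← hf, ← hg,
    e.length_eq]
  ring

lemma exists_generators_of_colength {E E' : Ideal A} (h : E ≤ E') (p : ℕ)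
    (hfin : colength E' ≠ ⊤) (hp : colength E ≤ colength E' + p) :
    ∃ f : Fin p → A, E' = E ⊔ Ideal.span (Set.range f) := by
  induction p generalizing E with
  | zero =>
    refine ⟨Fin.elim0, ?_⟩
    rw [← eq_of_le_of_colength_le h hfin (by simpa using hp)]
    simp
  | succ p ih =>
    by_cases hE : E = E'
    · subst hE
      refine ⟨fun _ => 0, ?_⟩
      simp
    · obtain ⟨x, hx, hxE⟩ := SetLike.exists_of_lt (lt_of_le_of_ne h hE)
      have hle : E ⊔ Ideal.span {x} ≤ E' := sup_le h ((Ideal.span_singleton_le_iff_mem _).2 hx)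
      have hEfin : colength E ≠ ⊤ := ne_top_of_le_ne_top
        (WithTop.add_ne_top.2 ⟨hfin, ENat.natCast_ne_top _⟩) hp
      have hlt : colength (E ⊔ Ideal.span {x}) < colength E := by
        refine lt_of_le_of_ne (colength_antitone le_sup_left) fun heq => hxE ?_
        rw [eq_of_le_of_colength_le (le_sup_left : E ≤ E ⊔ Ideal.span {x})
          (heq ▸ hEfin) heq.ge]
        exact Ideal.mem_sup_right (Ideal.mem_span_singleton_self x)
      obtain ⟨f, hf⟩ := ih hle (by
        have := hlt.trans_le hp
        rw [Nat.cast_succ, ← add_assoc] at this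
        exact (ENat.lt_add_one_iff (WithTop.add_ne_top.2 ⟨hfin, ENat.natCast_ne_top _⟩)).1 this)
      refine ⟨Fin.cons x f, ?_⟩
      rw [Fin.range_cons, Ideal.span_insert, ← sup_assoc, ← hf]

/-- The Koszul map `A/(F : Q) → (A/F)²` followed by `(A/F)² → A/QF` for `Q = (a, b)`. -/
lemma colength_mul_add_colon_le (a b : A) (F : Ideal A) :
    colength (Ideal.span {a, b} * F) + colength (F.colon (Ideal.span {a, b} : Set A)) ≤
        colength (Ideal.span {a, b}) + (colength F + colength F) ∧
      ((∀ r s : A, a * r + b * s = 0 → ∃ z, r = b * z ∧ s = -(a * z)) →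
        colength (Ideal.span {a, b} * F) + colength (F.colon (Ideal.span {a, b} : Set A)) =
          colength (Ideal.span {a, b}) + (colength F + colength F)) := by
  set Q : Ideal A := Ideal.span {a, b} with hQ
  have ha : a ∈ Q := Ideal.subset_span (by simp)
  have hb : b ∈ Q := Ideal.subset_span (by simp)
  let f1 : (A ⧸ F) →ₗ[A] (A ⧸ (Q * F)) :=
    Submodule.mapQ F (Q * F) (LinearMap.mulLeft A a) fun x hx => Ideal.mul_mem_mul ha hx
  let f2 : (A ⧸ F) →ₗ[A] (A ⧸ (Q * F)) :=
    Submodule.mapQ F (Q * F) (LinearMap.mulLeft A b) fun x hx => Ideal.mul_mem_mul hb hx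
  let ψ := f1.coprod f2
  have hψ : ∀ r s : A, ψ (F.mkQ r, F.mkQ s) = (Q * F).mkQ (a * r + b * s) := by
    intro r s; rw [map_add]; rfl
  have hrange : LinearMap.range ψ = Submodule.map (Q * F).mkQ Q := by
    ext z
    constructor
    · rintro ⟨⟨r, s⟩, rfl⟩
      obtain ⟨r, rfl⟩ := F.mkQ_surjective r
      obtain ⟨s, rfl⟩ := F.mkQ_surjective s
      rw [hψ]
      exact Submodule.mem_map_of_mem
        (Q.add_mem (Ideal.mul_mem_right _ _ ha) (Ideal.mul_mem_right _ _ hb))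
    · rintro ⟨z, hz, rfl⟩
      obtain ⟨r, s, rfl⟩ := Ideal.mem_span_pair.1 hz
      exact ⟨(F.mkQ r, F.mkQ s), by rw [hψ]; congr 1; ring⟩
  have hcol : ∀ z : A, z ∈ F.colon (Q : Set A) ↔ b * z ∈ F ∧ a * z ∈ F := by
    intro z
    rw [Submodule.mem_colon]
    constructor
    · intro h
      exact ⟨by simpa [mul_comm] using h b hb, by simpa [mul_comm] using h a ha⟩
    · rintro ⟨h1, h2⟩ s hs
      obtain ⟨u, v, rfl⟩ := Ideal.mem_span_pair.1 hs
      have : z • (u * a + v * b) = u * (a * z) + v * (b * z) := by simp; ring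
      rw [this]
      exact F.add_mem (F.mul_mem_left _ h2) (F.mul_mem_left _ h1)
  let φ₀ : A →ₗ[A] (A ⧸ F) × (A ⧸ F) :=
    (F.mkQ ∘ₗ LinearMap.mulLeft A b).prod (F.mkQ ∘ₗ LinearMap.mulLeft A (-a))
  have hφ₀ : ∀ z, φ₀ z = (F.mkQ (b * z), F.mkQ (-(a * z))) := by intro z; simp [φ₀]
  have hkerφ : LinearMap.ker φ₀ = F.colon (Q : Set A) := by
    ext z
    rw [LinearMap.mem_ker, hφ₀, hcol, Prod.mk_eq_zero]
    simp only [Submodule.mkQ_apply, Submodule.Quotient.mk_eq_zero, neg_mem_iff]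
  have hcolon : colength (F.colon (Q : Set A)) = Module.length A (LinearMap.range φ₀) := by
    rw [← φ₀.quotKerEquivRange.length_eq, (Submodule.quotEquivOfEq _ _ hkerφ).length_eq]; rfl
  have hle : LinearMap.range φ₀ ≤ LinearMap.ker ψ := by
    rintro _ ⟨z, rfl⟩
    rw [LinearMap.mem_ker, hφ₀, hψ]
    rw [show a * (b * z) + b * -(a * z) = 0 by ring, map_zero]
  have hQF : colength (Q * F) = colength Q + Module.length A (LinearMap.range ψ) := by
    rw [colength_eq_add_of_le (Ideal.mul_le_left : Q * F ≤ Q), hrange]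
  have hsum : colength F + colength F =
      Module.length A (LinearMap.ker ψ) + Module.length A (LinearMap.range ψ) := by
    rw [← length_eq_ker_add_range ψ, Module.length_prod]; rfl
  constructor
  · rw [hQF, hsum, hcolon, add_assoc, add_comm (Module.length A (LinearMap.range ψ))]
    gcongr
    exact Module.length_le_of_injective (Submodule.inclusion hle) (Submodule.inclusion_injective _)
  · intro hsyz
    have heq : LinearMap.range φ₀ = LinearMap.ker ψ := by
      refine le_antisymm hle ?_
      rintro ⟨r, s⟩ hrs
      obtain ⟨r, rfl⟩ := F.mkQ_surjective r
      obtain ⟨s, rfl⟩ := F.mkQ_surjective s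
      rw [LinearMap.mem_ker, hψ] at hrs
      have hrs' : a * r + b * s ∈ Q * F := (Submodule.Quotient.mk_eq_zero _).1 hrs
      rw [hQ, Ideal.span_insert, Ideal.sup_mul] at hrs'
      obtain ⟨_, h1, _, h2, h12⟩ := Submodule.mem_sup.1 hrs'
      obtain ⟨u, hu, rfl⟩ := Ideal.mem_span_singleton_mul.1 h1
      obtain ⟨v, hv, rfl⟩ := Ideal.mem_span_singleton_mul.1 h2
      obtain ⟨z, hz1, hz2⟩ := hsyz (r - u) (s - v) (by linear_combination -h12)
      refine ⟨z, ?_⟩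
      rw [hφ₀, ← hz1, ← hz2, map_sub, map_sub]
      have hu' : F.mkQ u = 0 := (Submodule.Quotient.mk_eq_zero F).2 hu
      have hv' : F.mkQ v = 0 := (Submodule.Quotient.mk_eq_zero F).2 hv
      rw [hu', hv', sub_zero, sub_zero]
    rw [hQF, hsum, hcolon, heq]
    ring

end Colength

section Determinant

open Matrix

/-- A determinant trick: if `α i • m i` is congruent to a combination of the `m j` whose coefficients
are trivial modulo `𝔮` for `d j ≤ d i`, then `∏ α i` moves every combination of the `m j` into
`𝔮`. -/
lemma prod_mul_mem_of_determinant {R P ι : Type*} [CommRing R] [CommRing P] [Algebra R P]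
    [Fintype ι] [DecidableEq ι] (𝔮 : Submodule R P) (d : ι → ℕ) (α : ι → R) (s : Matrix ι ι R)
    (m : ι → P) (hs : ∀ i j, d j ≤ d i → algebraMap R P (s i j) ∈ 𝔮)
    (hm : ∀ i, α i • m i - ∑ j, s i j • m j ∈ 𝔮) (z : R) (q : ι → R)
    (hz : algebraMap R P z - ∑ j, q j • m j ∈ 𝔮) :
    algebraMap R P ((∏ i, α i) * z) ∈ 𝔮 := by
  set 𝔠 : Ideal R := 𝔮.comap (Algebra.linearMap R P)
  set B : Matrix ι ι R := diagonal α - s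
  have hB : ∀ i, ∑ j, B i j • m j ∈ 𝔮 := by
    intro i
    have : ∑ j, B i j • m j = α i • m i - ∑ j, s i j • m j := by
      simp [B, sub_smul, Finset.sum_sub_distrib, diagonal_apply]
    rw [this]; exact hm i
  have hdet : ∀ k, B.det • m k ∈ 𝔮 := by
    intro k
    have h1 : ∑ i, B.adjugate k i • ∑ j, B i j • m j = B.det • m k := by
      simp_rw [Finset.smul_sum, smul_smul]
      rw [Finset.sum_comm]
      simp_rw [← Finset.sum_smul, ← mul_apply, adjugate_mul]
      simp [one_apply]
    rw [← h1]
    exact 𝔮.sum_mem fun i _ => 𝔮.smul_mem _ (hB i)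
  have hdz : B.det • algebraMap R P z ∈ 𝔮 := by
    have : B.det • algebraMap R P z = B.det • (algebraMap R P z - ∑ j, q j • m j) +
        ∑ j, q j • (B.det • m j) := by
      simp_rw [smul_sub, Finset.smul_sum, smul_comm B.det]; abel
    rw [this]
    exact 𝔮.add_mem (𝔮.smul_mem _ hz) (𝔮.sum_mem fun j _ => 𝔮.smul_mem _ (hdet j))
  have hprod : Ideal.Quotient.mk 𝔠 B.det = Ideal.Quotient.mk 𝔠 (∏ i, α i) := by
    have hsq : ∀ i j, d j ≤ d i → Ideal.Quotient.mk 𝔠 (s i j) = 0 := fun i j h =>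
      Ideal.Quotient.eq_zero_iff_mem.2 (hs i j h)
    rw [det_apply, map_sum, Finset.sum_eq_single 1]
    · simp [B, map_prod, hsq]
    · intro σ _ hσ
      obtain ⟨i, hi, hdi⟩ : ∃ i, σ i ≠ i ∧ d i ≤ d (σ i) := by
        by_contra! hcon
        obtain ⟨i, hi⟩ : ∃ i, σ i ≠ i := by
          by_contra! h; exact hσ (Equiv.ext h)
        refine (Finset.sum_lt_sum (s := Finset.univ) (f := fun i => d (σ i)) (g := d)
          (fun j _ => ?_) ⟨i, Finset.mem_univ _, hcon i hi⟩).ne (Equiv.sum_comp σ d)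
        by_cases hj : σ j = j
        · rw [hj]
        · exact (hcon j hj).le
      rw [Units.smul_def, map_zsmul, map_prod, Finset.prod_eq_zero (Finset.mem_univ i), smul_zero]
      simp [B, diagonal_apply_ne _ hi, hsq _ _ hdi]
    · simp
  have hmem : (∏ i, α i) - B.det ∈ 𝔠 := Ideal.Quotient.eq.1 hprod.symm
  have h2 : algebraMap R P (((∏ i, α i) - B.det) * z) ∈ 𝔮 := 𝔠.mul_mem_right z hmem
  have h3 : algebraMap R P ((∏ i, α i) * z) =
      algebraMap R P (((∏ i, α i) - B.det) * z) + B.det • algebraMap R P z := by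
    rw [Algebra.smul_def, ← map_mul, ← map_add]; congr 1; ring
  rw [h3]
  exact 𝔮.add_mem h2 hdz

end Determinant

section ReesSubmodule

open Polynomial

variable {A : Type*} [CommRing A]

lemma pow_mul_le_of_mul_le {I : Ideal A} {W : ℕ → Ideal A} (hW : ∀ n, I * W n ≤ W (n + 1))
    (i j : ℕ) : I ^ i * W j ≤ W (i + j) := by
  induction i with
  | zero => simp
  | succ i ih =>
    calc I ^ (i + 1) * W j = I * (I ^ i * W j) := by rw [pow_succ', mul_assoc]
      _ ≤ I * W (i + j) := Ideal.mul_mono_right ih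
      _ ≤ W (i + j + 1) := hW _
      _ = W (i + 1 + j) := by congr 1; omega

lemma algebraMap_reesAlgebra {I : Ideal A} (r : reesAlgebra I) :
    algebraMap (reesAlgebra I) A[X] r = (r : A[X]) := rfl

/-- The Rees submodule `⊕ W n tⁿ` of `A[t]` attached to ideals with `I * W n ≤ W (n + 1)`. -/
def reesSubmodule (I : Ideal A) (W : ℕ → Ideal A) (hW : ∀ n, I * W n ≤ W (n + 1)) :
    Submodule (reesAlgebra I) A[X] where
  carrier := {f | ∀ n, f.coeff n ∈ W n}
  add_mem' hf hg n := by rw [coeff_add]; exact (W n).add_mem (hf n) (hg n)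
  zero_mem' n := by simp
  smul_mem' r f hf n := by
    rw [Algebra.smul_def, algebraMap_reesAlgebra, coeff_mul]
    refine (W n).sum_mem fun ⟨i, j⟩ h => ?_
    rw [← Finset.HasAntidiagonal.mem_antidiagonal.1 h]
    exact pow_mul_le_of_mul_le hW i j (Ideal.mul_mem_mul (r.2 i) (hf j))

lemma monomial_mem_reesSubmodule {I : Ideal A} {W : ℕ → Ideal A}
    {hW : ∀ n, I * W n ≤ W (n + 1)} {n : ℕ} {a : A} :
    monomial n a ∈ reesSubmodule I W hW ↔ a ∈ W n := by
  refine ⟨fun h => by simpa using h n, fun h k => ?_⟩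
  rw [coeff_monomial]
  split_ifs with hk
  · exact hk ▸ h
  · exact zero_mem _

lemma prod_const_le_span {ι : Type*} (I : Ideal A) (s : Finset ι) :
    I ^ s.card ≤ Ideal.span {x | ∃ a : ι → A, (∀ i, a i ∈ I) ∧ x = ∏ i ∈ s, a i} := by
  classical
  induction s using Finset.induction_on with
  | empty =>
    rw [Finset.card_empty, pow_zero, Ideal.one_eq_top]
    refine ((Ideal.eq_top_iff_one _).2 (Ideal.subset_span ?_)).ge
    exact ⟨0, fun _ => zero_mem _, by simp⟩
  | insert k s hk ih =>
    rw [Finset.card_insert_of_notMem hk, pow_succ']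
    refine (Ideal.mul_mono_right ih).trans (Ideal.mul_le.2 fun c hc x hx => ?_)
    refine Submodule.span_induction ?_ (by simp) (fun x y _ _ hx hy => ?_) (fun r x _ hx => ?_) hx
    · rintro _ ⟨a, ha, rfl⟩
      refine Ideal.subset_span ⟨Function.update a k c, fun i => ?_, ?_⟩
      · by_cases hi : i = k
        · subst hi; simpa
        · simpa [hi] using ha i
      · rw [Finset.prod_insert hk, Function.update_self]
        congr 1
        exact Finset.prod_congr rfl fun i hi => by
          rw [Function.update_of_ne (ne_of_mem_of_not_mem hi hk)]
    · rw [mul_add]; exact Ideal.add_mem _ hx hy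
    · rw [smul_eq_mul, mul_left_comm]; exact Ideal.mul_mem_left _ _ hx

lemma pow_card_add_two_le {I Q : Ideal A} (hQI : Q ≤ I) (F : ℕ → Ideal A) (hIF : I ≤ F 1)
    (hF : ∀ n, I * F n ≤ F (n + 1)) {ι : Type*} [Fintype ι] (d : ι → ℕ) (m : ι → A)
    (hm : ∀ j, m j ∈ F (d j + 1))
    (hgen : ∀ n, ∀ z ∈ F (n + 1), ∃ q : ι → A, (∀ j, d j ≤ n → q j ∈ Q ^ (n - d j)) ∧
      (∀ j, n < d j → q j = 0) ∧ z - ∑ j, q j * m j ∈ Q ^ n * I) :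
    I ^ (Fintype.card ι + 2) ≤ Q * I ^ (Fintype.card ι + 1) := by
  classical
  let W : ℕ → Ideal A := fun n => match n with
    | 0 => ⊥
    | n + 1 => Q * I ^ n
  have hW : ∀ n, I * W n ≤ W (n + 1) := by
    rintro (_ | n)
    · simp [W]
    · simp only [W]; rw [pow_succ']; exact (mul_left_comm _ _ _).le
  have hWn : ∀ n, Q ^ (n + 1) * I ≤ W (n + 2) := fun n => by
    simp only [W]
    rw [pow_succ', mul_assoc, pow_succ I n]
    exact Ideal.mul_mono_right (Ideal.mul_mono_left (Ideal.pow_right_mono hQI n))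
  set 𝔮 := reesSubmodule I W hW
  have key : ∀ (a : ι → A) (c x : A), (∀ i, a i ∈ I) → c ∈ I → x ∈ I →
      (∏ i, a i) * (c * x) ∈ Q * I ^ (Fintype.card ι + 1) := by
    intro a c x ha hc hx
    have hgen' : ∀ i, _ := fun i =>
      hgen (d i + 1) (a i * m i) (hF _ (Ideal.mul_mem_mul (ha i) (hm i)))
    choose s hs1 hs2 hs3 using hgen'
    obtain ⟨q, hq1, hq2, hq3⟩ := hgen 1 (c * x) (hF _ (Ideal.mul_mem_mul hc (hIF hx)))
    have hmemS : ∀ (n : ℕ) (j : ι) (r : A), (d j ≤ n → r ∈ Q ^ (n - d j)) → (n < d j → r = 0) →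
        monomial (n - d j) r ∈ reesAlgebra I := fun n j r h1 h2 => by
      rcases le_or_gt (d j) n with h | h
      · exact reesAlgebra.monomial_mem.2 (Ideal.pow_right_mono hQI _ (h1 h))
      · rw [h2 h, map_zero]; exact zero_mem _
    have hsmul : ∀ (n : ℕ) (j : ι) (r : A) (h : monomial (n - d j) r ∈ reesAlgebra I),
        (n < d j → r = 0) → (⟨_, h⟩ : reesAlgebra I) • (monomial (d j + 1) (m j) : A[X]) =
          monomial (n + 1) (r * m j) := fun n j r h h2 => by
      rw [Algebra.smul_def, algebraMap_reesAlgebra, monomial_mul_monomial]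
      rcases le_or_gt (d j) n with h | h
      · rw [show n - d j + (d j + 1) = n + 1 by omega]
      · simp [h2 h]
    have hprod : (∏ i, (⟨monomial 1 (a i),
          reesAlgebra.monomial_mem.2 (by simpa using ha i)⟩ : reesAlgebra I) : reesAlgebra I).1 =
        monomial (Fintype.card ι) (∏ i, a i) := by
      rw [SubmonoidClass.coe_finsetProd]
      simp_rw [← C_mul_X_pow_eq_monomial, pow_one]
      rw [Finset.prod_mul_distrib, map_prod]
      simp
    have hcx : c * x ∈ I ^ 2 := by rw [pow_two]; exact Ideal.mul_mem_mul hc hx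
    have := prod_mul_mem_of_determinant 𝔮 d
      (fun i => (⟨monomial 1 (a i), reesAlgebra.monomial_mem.2 (by simpa using ha i)⟩ :
        reesAlgebra I))
      (fun i j => ⟨monomial (d i + 1 - d j) (s i j), hmemS _ _ _ (hs1 i j) (hs2 i j)⟩)
      (fun j => monomial (d j + 1) (m j))
      (fun i j hij => monomial_mem_reesSubmodule.2 (by
        have h1 := hs1 i j (by omega)
        obtain ⟨k, hk⟩ : ∃ k, d i + 1 - d j = k + 1 := ⟨d i - d j, by omega⟩
        rw [hk] at h1 ⊢
        rw [pow_succ'] at h1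
        exact Ideal.mul_mono_right (Ideal.pow_right_mono hQI k) h1))
      (fun i => by
        simp_rw [fun j => hsmul (d i + 1) j (s i j) (hmemS _ _ _ (hs1 i j) (hs2 i j)) (hs2 i j)]
        rw [Algebra.smul_def, algebraMap_reesAlgebra, monomial_mul_monomial, ← map_sum,
          show 1 + (d i + 1) = d i + 1 + 1 by omega, ← map_sub]
        exact monomial_mem_reesSubmodule.2 (hWn _ (hs3 i)))
      ⟨monomial 2 (c * x), reesAlgebra.monomial_mem.2 hcx⟩
      (fun j => ⟨monomial (1 - d j) (q j), hmemS _ _ _ (hq1 j) (hq2 j)⟩)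
      (by
        simp_rw [fun j => hsmul 1 j (q j) (hmemS _ _ _ (hq1 j) (hq2 j)) (hq2 j)]
        rw [algebraMap_reesAlgebra, ← map_sum, ← map_sub]
        exact monomial_mem_reesSubmodule.2 (hWn 0 (by simpa using hq3)))
    rw [algebraMap_reesAlgebra, Subalgebra.coe_mul, hprod, monomial_mul_monomial] at this
    exact monomial_mem_reesSubmodule.1 this
  rw [pow_add, pow_two]
  have hspan := prod_const_le_span I (Finset.univ : Finset ι)
  rw [Finset.card_univ] at hspan
  refine (Ideal.mul_mono_left hspan).trans (Ideal.mul_le.2 fun y hy w hw => ?_)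
  refine Submodule.span_induction ?_ (by simp) (fun x y _ _ hx hy => ?_) (fun r x _ hx => ?_) hy
  · rintro _ ⟨a, ha, rfl⟩
    refine Submodule.mul_induction_on hw (fun c hc x hx => key a c x ha hc hx) fun u v hu hv => ?_
    rw [mul_add]; exact Ideal.add_mem _ hu hv
  · rw [add_mul]; exact Ideal.add_mem _ hx hy
  · rw [smul_eq_mul, mul_assoc]; exact Ideal.mul_mem_left _ _ hx

/-- If `F 1 / I` and the `F (n + 1) / Q F n`, `n ≥ 1`, have finitely many generators in total, say
`p`, then `I ^ (p + 2) ≤ Q * I ^ (p + 1)`. -/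
lemma pow_sum_add_two_le {I Q : Ideal A} (hQI : Q ≤ I) (F : ℕ → Ideal A)
    (hF : ∀ n, I * F n ≤ F (n + 1)) (N : ℕ) (p : ℕ → ℕ) (f : ∀ n, Fin (p n) → A)
    (h0 : F 1 = I ⊔ Ideal.span (Set.range (f 0)))
    (h1 : ∀ n, F (n + 2) = Q * F (n + 1) ⊔ Ideal.span (Set.range (f (n + 1))))
    (hN : ∀ n, N ≤ n → p n = 0) :
    I ^ (∑ n ∈ Finset.range N, p n + 2) ≤ Q * I ^ (∑ n ∈ Finset.range N, p n + 1) := by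
  let ι := Σ n : Fin N, Fin (p n)
  let d : ι → ℕ := fun j => j.1
  let m : ι → A := fun j => f j.1 j.2
  have hcard : Fintype.card ι = ∑ n ∈ Finset.range N, p n := by
    simp [ι, Finset.sum_range]
  let T : ℕ → ι → Ideal A := fun n j =>
    (if d j ≤ n then Q ^ (n - d j) else ⊥) * Ideal.span {m j}
  have hTf : ∀ n, Ideal.span (Set.range (f n)) ≤ ⨆ j ∈ (Finset.univ : Finset ι), T n j := by
    intro n
    rw [Ideal.span_le]
    rintro _ ⟨k, rfl⟩
    have hn : n < N := by
      by_contra! h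
      exact Fin.elim0 (Fin.cast (hN n h) k)
    refine Submodule.mem_iSup_of_mem (⟨⟨n, hn⟩, k⟩ : ι)
      (Submodule.mem_iSup_of_mem (Finset.mem_univ _) ?_)
    simp only [T, d, m, le_refl, if_true, Nat.sub_self, pow_zero, one_mul]
    exact Ideal.mem_span_singleton_self _
  have hT : ∀ n, F (n + 1) ≤ Q ^ n * I ⊔ ⨆ j ∈ (Finset.univ : Finset ι), T n j := by
    intro n
    induction n with
    | zero => rw [h0, pow_zero, one_mul]; exact sup_le_sup_left (hTf 0) _
    | succ n ih =>
      rw [h1]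
      refine sup_le ((Ideal.mul_mono_right ih).trans ?_) ((hTf _).trans le_sup_right)
      rw [Ideal.mul_sup, ← mul_assoc, ← pow_succ']
      refine sup_le_sup_left ?_ _
      simp_rw [Ideal.mul_iSup]
      refine iSup₂_mono fun j _ => ?_
      simp only [T]
      rw [← mul_assoc]
      refine Ideal.mul_mono_left ?_
      by_cases h : d j ≤ n
      · rw [if_pos h, if_pos (by omega), ← pow_succ', Nat.sub_add_comm h]
      · rw [if_neg h]; simp
  have hQpow : ∀ n k, Q ^ k * F n ≤ F (k + n) := fun n k =>
    (Ideal.mul_mono_left (Ideal.pow_right_mono hQI k)).trans (pow_mul_le_of_mul_le hF k n)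
  rw [← hcard]
  refine pow_card_add_two_le hQI F (h0 ▸ le_sup_left) hF d m (fun j => ?_) fun n z hz => ?_
  · have hmem : m j ∈ Ideal.span (Set.range (f j.1)) := Ideal.subset_span ⟨j.2, rfl⟩
    obtain ⟨⟨n, hn⟩, k⟩ := j
    rcases n with _ | n
    · rw [show d _ = 0 from rfl, h0]; exact Ideal.mem_sup_right hmem
    · rw [show d _ = n + 1 from rfl, h1]; exact Ideal.mem_sup_right hmem
  · obtain ⟨u, hu, v, hv, rfl⟩ := Submodule.mem_sup.1 (hT n hz)
    obtain ⟨μ, rfl⟩ := (Submodule.mem_iSup_finset_iff_exists_sum _ _).1 hv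
    have hμ : ∀ j, ∃ q ∈ (if d j ≤ n then Q ^ (n - d j) else ⊥), q * m j = μ j := fun j => by
      obtain ⟨q, hq, h⟩ := Ideal.mem_mul_span_singleton.1 (μ j).2
      exact ⟨q, hq, h⟩
    choose q hq hqm using hμ
    refine ⟨q, fun j hj => ?_, fun j hj => ?_, ?_⟩
    · have := hq j; rwa [if_pos hj] at this
    · have := hq j; rwa [if_neg (by omega)] at this
    · simp_rw [hqm]; rwa [add_sub_cancel_right]

end ReesSubmodule

section RatliffRush

variable {A : Type*} [CommRing A]

lemma exists_syzygy_of_mem_span_pair {a b x y : A} (hx : ∀ z, x * z = 0 → z = 0)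
    (hy : ∀ z, x ∣ y * z → x ∣ z) (hxQ : x ∈ Ideal.span {a, b}) (hyQ : y ∈ Ideal.span {a, b})
    (r s : A) (h : a * r + b * s = 0) : ∃ z, r = b * z ∧ s = -(a * z) := by
  obtain ⟨α, β, hαβ⟩ := Ideal.mem_span_pair.1 hxQ
  obtain ⟨γ, δ, hγδ⟩ := Ideal.mem_span_pair.1 hyQ
  have h1 : x * r = b * (β * r - α * s) := by linear_combination -r * hαβ + α * h
  have h2 : x * s = -(a * (β * r - α * s)) := by linear_combination -s * hαβ + β * h
  obtain ⟨w, hw⟩ := hy (β * r - α * s) ⟨δ * r - γ * s, by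
    linear_combination -(β * r - α * s) * hγδ + (δ * r - γ * s) * hαβ + (β * γ - α * δ) * h⟩
  rw [hw] at h1 h2
  refine ⟨w, ?_, ?_⟩
  · exact sub_eq_zero.1 (hx _ (by linear_combination h1))
  · exact sub_eq_zero.1 (hx _ (by linear_combination h2))

lemma eq_zero_of_pow_mul_eq_zero {x : A} (hx : ∀ z, x * z = 0 → z = 0) (k : ℕ) :
    ∀ z, x ^ k * z = 0 → z = 0 := by
  induction k with
  | zero => intro z hz; simpa using hz
  | succ k ih => intro z hz; exact ih z (hx _ (by rw [← hz]; ring))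

lemma dvd_of_dvd_pow_mul {x y : A} (hy : ∀ z, x ∣ y * z → x ∣ z) (l : ℕ) :
    ∀ z, x ∣ y ^ l * z → x ∣ z := by
  induction l with
  | zero => intro z hz; simpa using hz
  | succ l ih => intro z hz; exact ih z (hy _ (by rwa [← mul_assoc, ← pow_succ']))

lemma pow_dvd_of_pow_dvd_pow_mul {x y : A} (hx : ∀ z, x * z = 0 → z = 0)
    (hy : ∀ z, x ∣ y * z → x ∣ z) (k l : ℕ) : ∀ z, x ^ k ∣ y ^ l * z → x ^ k ∣ z := by
  induction k with
  | zero => intro z _; simp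
  | succ k ih =>
    intro z hz
    obtain ⟨w, rfl⟩ := dvd_of_dvd_pow_mul hy l z ((dvd_pow_self x k.succ_ne_zero).trans hz)
    obtain ⟨u, hu⟩ := hz
    have : x ^ k ∣ w := ih w ⟨u, sub_eq_zero.1 (hx _ (by linear_combination hu))⟩
    rw [pow_succ']
    exact mul_dvd_mul_left x this

lemma exists_pow_colon_le [IsNoetherianRing A] {Q J : Ideal A} {K : ℕ}
    (hK : J ^ (K + 1) = Q * J ^ K) {a : A} (ha : a ∈ Q) (hreg : ∀ z, a * z = 0 → z = 0) :
    ∃ n₁, ∀ n ≥ n₁, (J ^ (n + 1)).colon (Q : Set A) ≤ J ^ n := by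
  let E : ℕ → Ideal A := fun n => (J ^ (n + 1)).colon (Q : Set A)
  have hE : ∀ {n x}, x ∈ E n ↔ ∀ q ∈ Q, x * q ∈ J ^ (n + 1) := Submodule.mem_colon
  have hJE : ∀ n, J * E n ≤ E (n + 1) := fun n => Ideal.mul_le.2 fun r hr x hx =>
    hE.2 fun q hq => by
      rw [mul_assoc, pow_succ']; exact Ideal.mul_mem_mul hr (hE.1 hx q hq)
  let N : J.Filtration A :=
    { N := fun n => Ideal.span {a} * E n
      mono := fun n => Ideal.mul_mono_right fun x hx => hE.2 fun q hq =>
        Ideal.pow_le_pow_right (Nat.le_succ _) (hE.1 hx q hq)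
      smul_le := fun n => by
        rw [smul_eq_mul, mul_left_comm]; exact Ideal.mul_mono_right (hJE n) }
  have hN : N ≤ J.stableFiltration ⊤ := fun n => by
    change Ideal.span {a} * E n ≤ J ^ n • (⊤ : Ideal A)
    rw [smul_eq_mul, Ideal.mul_top]
    refine Ideal.mul_le.2 fun r hr x hx => ?_
    obtain ⟨u, rfl⟩ := Ideal.mem_span_singleton'.1 hr
    rw [show u * a * x = u * (x * a) by ring]
    exact Ideal.mul_mem_left _ _ (Ideal.pow_le_pow_right (Nat.le_succ _) (hE.1 hx a ha))
  obtain ⟨n₀, hn₀⟩ := ((J.stableFiltration_stable ⊤).of_le hN).exists_pow_smul_eq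
  refine ⟨n₀ + (K + 1), fun n hn x hx => ?_⟩
  obtain ⟨k, rfl⟩ := Nat.exists_eq_add_of_le hn
  have h1 : a * x ∈ Ideal.span {a} * (J ^ (K + 1 + k) * E n₀) := by
    have h2 : a * x ∈ N.N (n₀ + (K + 1 + k)) := by
      rw [← add_assoc]
      exact Ideal.mul_mem_mul (Ideal.mem_span_singleton_self a) hx
    rw [hn₀] at h2
    rw [mul_left_comm]; exact h2
  obtain ⟨w, hw, hwx⟩ := Ideal.mem_span_singleton_mul.1 h1
  have hxw : x = w := sub_eq_zero.1 (hreg _ (by linear_combination -hwx))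
  have hQE : Q * E n₀ ≤ J ^ (n₀ + 1) := Ideal.mul_le.2 fun q hq y hy => by
    rw [mul_comm]; exact hE.1 hy q hq
  rw [hxw]
  have h3 : J ^ (K + 1 + k) * E n₀ ≤ J ^ (n₀ + (K + 1) + k) := by
    calc J ^ (K + 1 + k) * E n₀ = J ^ (K + k) * (Q * E n₀) := by
          rw [pow_add, hK, pow_add]; ring
      _ ≤ J ^ (K + k) * J ^ (n₀ + 1) := Ideal.mul_mono_right hQE
      _ = _ := by rw [← pow_add]; congr 1; omega
  exact h3 hw

/-- The Ratliff–Rush filtration of `J` computed with an exponent past which `J ^ (n + 1) : Q` is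
`J ^ n`. -/
lemma ratliffRush_properties {Q J : Ideal A} (hQJ : Q ≤ J) {T : ℕ}
    (hT : ∀ n ≥ T, (J ^ (n + 1)).colon (Q : Set A) ≤ J ^ n) (F : ℕ → Ideal A)
    (hF : ∀ n, F n = (J ^ (n + T)).colon ((J ^ T : Ideal A) : Set A)) :
    F 0 = ⊤ ∧ (∀ n, J ^ n ≤ F n) ∧ (∀ n, J * F n ≤ F (n + 1)) ∧
      (∀ n, (F (n + 1)).colon (Q : Set A) = F n) ∧ ∀ n ≥ T, F n = J ^ n := by
  have hmem : ∀ {n x}, x ∈ F n ↔ ∀ w ∈ J ^ T, x * w ∈ J ^ (n + T) := fun {n x} => by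
    rw [hF]; exact Submodule.mem_colon
  have hJF : ∀ n, J * F n ≤ F (n + 1) := fun n => Ideal.mul_le.2 fun r hr x hx =>
    hmem.2 fun w hw => by
      rw [mul_assoc, Nat.add_right_comm, pow_succ']; exact Ideal.mul_mem_mul hr (hmem.1 hx w hw)
  have hle : ∀ n, J ^ n ≤ F n := fun n x hx => hmem.2 fun w hw => by
    rw [pow_add]; exact Ideal.mul_mem_mul hx hw
  refine ⟨?_, hle, hJF, fun n => le_antisymm (fun x hx => hmem.2 fun w hw => ?_)
    fun x hx => Submodule.mem_colon.2 fun q hq => ?_, fun n hn => le_antisymm ?_ (hle n)⟩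
  · rw [Ideal.eq_top_iff_one, hmem]
    intro w hw; simpa using hw
  · refine hT _ (Nat.le_add_left _ _) (Submodule.mem_colon.2 fun q hq => ?_)
    have := hmem.1 (Submodule.mem_colon.1 hx q hq) w hw
    rw [smul_eq_mul] at this ⊢
    rw [show x * w * q = x * q * w by ring, Nat.add_right_comm]
    exact this
  · rw [smul_eq_mul, mul_comm]
    exact hJF n (Ideal.mul_mem_mul (hQJ hq) hx)
  · have key : ∀ k x, (∀ w ∈ J ^ k, x * w ∈ J ^ (n + k)) → x ∈ J ^ n := by
      intro k
      induction k with
      | zero => intro x hx; simpa using hx 1 (by simp)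
      | succ k ih =>
        intro x hx
        refine ih x fun w hw => hT _ (by omega) (Submodule.mem_colon.2 fun q hq => ?_)
        rw [smul_eq_mul, mul_assoc]
        exact hx _ (by rw [pow_succ]; exact Ideal.mul_mem_mul hw (hQJ hq))
    exact fun x hx => key T x (hmem.1 hx)

end RatliffRush

section Reduction

variable {A : Type*} [CommRing A]

lemma isReduction_of_pow_le {K L : Ideal A} (h : K ≤ L) {n : ℕ} (hn : L ^ (n + 1) ≤ K * L ^ n) :
    IsReduction K L :=
  ⟨h, n, le_antisymm hn (by rw [pow_succ']; exact Ideal.mul_mono_left h)⟩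

lemma pow_add_eq_of_pow_succ_eq {K L : Ideal A} {n : ℕ} (hn : L ^ (n + 1) = K * L ^ n) (j : ℕ) :
    L ^ (j + n) = K ^ j * L ^ n := by
  induction j with
  | zero => simp
  | succ j ih =>
    calc L ^ (j + 1 + n) = L * L ^ (j + n) := by rw [← pow_succ']; congr 1; omega
      _ = K ^ j * L ^ (n + 1) := by rw [ih, pow_succ']; ring
      _ = K ^ (j + 1) * L ^ n := by rw [hn, pow_succ]; ring

lemma IsReduction.trans {I K L : Ideal A} (h₁ : IsReduction I K) (h₂ : IsReduction K L) :
    IsReduction I L := by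
  obtain ⟨hIK, m, hm⟩ := h₁
  obtain ⟨hKL, n, hn⟩ := h₂
  refine isReduction_of_pow_le (hIK.trans hKL) (n := m + n) ?_
  rw [Nat.add_right_comm, pow_add_eq_of_pow_succ_eq hn, hm, mul_assoc, pow_add]
  exact Ideal.mul_mono_right (Ideal.mul_mono_left (Ideal.pow_right_mono hKL m))

lemma isReduction_sup_span_singleton {I K : Ideal A} (hIK : I ≤ K) {x : A} (hx : x ∈ idealIC I) :
    IsReduction K (K ⊔ Ideal.span {x}) := by
  set L := K ⊔ Ideal.span {x}
  have hKL : K ≤ L := le_sup_left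
  have hxL : x ∈ L := Ideal.mem_sup_right (Ideal.mem_span_singleton_self x)
  have hpow : ∀ n, L ^ (n + 1) ≤ K * L ^ n ⊔ Ideal.span {x ^ (n + 1)} := by
    intro n
    induction n with
    | zero => simp [L]
    | succ n ih =>
      rw [pow_succ' L (n + 1)]
      refine (Ideal.mul_mono_right ih).trans ?_
      rw [Ideal.mul_sup]
      refine sup_le (le_sup_of_le_left ?_) ?_
      · rw [mul_left_comm, ← pow_succ']
      · rw [Ideal.sup_mul, Ideal.span_singleton_mul_span_singleton, ← pow_succ']
        refine sup_le_sup_right (Ideal.mul_mono_right ?_) _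
        exact (Ideal.span_singleton_le_iff_mem _).2 (Ideal.pow_mem_pow hxL _)
  obtain ⟨m, hm, c, hc, hxm⟩ := hx
  obtain ⟨n, rfl⟩ : ∃ n, m = n + 1 := ⟨m - 1, by omega⟩
  refine isReduction_of_pow_le hKL (n := n) ((hpow n).trans (sup_le le_rfl ?_))
  rw [Ideal.span_singleton_le_iff_mem, eq_neg_of_add_eq_zero_left hxm]
  refine neg_mem (Ideal.sum_mem _ fun i hi => ?_)
  have hi' := Finset.mem_Icc.1 hi
  obtain ⟨j, rfl⟩ : ∃ j, i = j + 1 := ⟨i - 1, by omega⟩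
  have h1 : c (j + 1) ∈ K * L ^ j := by
    have := Ideal.pow_right_mono hIK _ (hc _ hi)
    rw [pow_succ'] at this
    exact Ideal.mul_mono_right (Ideal.pow_right_mono hKL j) this
  have h2 := Ideal.mul_mem_mul h1 (Ideal.pow_mem_pow hxL (n + 1 - (j + 1)))
  rwa [mul_assoc, ← pow_add, show j + (n + 1 - (j + 1)) = n by omega] at h2

lemma isReduction_of_subset_idealIC [IsNoetherianRing A] {I J : Ideal A} (hIJ : I ≤ J)
    (hJ : (J : Set A) ⊆ idealIC I) : IsReduction I J := by
  classical
  obtain ⟨s, rfl⟩ : J.FG := IsNoetherian.noetherian J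
  have key : ∀ t : Finset A, (t : Set A) ⊆ idealIC I → IsReduction I (I ⊔ Ideal.span t) := by
    intro t
    induction t using Finset.induction_on with
    | empty => intro _; simpa using isReduction_of_pow_le le_rfl (n := 0) (by simp)
    | insert x t _ ih =>
      intro ht
      rw [Finset.coe_insert, Set.insert_subset_iff] at ht
      have := (ih ht.2).trans (isReduction_sup_span_singleton le_sup_left ht.1)
      rwa [sup_assoc, sup_comm (Ideal.span (t : Set A)), ← Ideal.span_insert,
        ← Finset.coe_insert] at this
  have := key s (Ideal.subset_span.trans hJ)
  rwa [sup_eq_right.2 hIJ] at this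

lemma IsMinimalReduction.eq_of_isReduction {Q I Q' : Ideal A} (hQ : IsMinimalReduction Q I)
    (h : IsReduction Q' Q) : Q' = Q :=
  hQ.2 Q' h.1 (h.trans hQ.1)

end Reduction

section FilterRegular

open Polynomial

variable {A : Type*} [CommRing A]

lemma exists_forall_notMem_of_infinite_residueField [IsLocalRing A] [Infinite (ResidueField A)]
    {M : Type*} [AddCommGroup M] [Module A M] (S : Finset (Submodule A M)) (hS : ⊤ ∉ S) :
    ∃ y : M, ∀ p ∈ S, y ∉ p := by
  classical
  induction S using Finset.induction_on with
  | empty => exact ⟨0, by simp⟩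
  | insert p S _ ih =>
    rw [Finset.mem_insert, not_or] at hS
    obtain ⟨y, hy⟩ := ih hS.2
    obtain ⟨z, hz⟩ : ∃ z, z ∉ p := by
      by_contra! h
      exact hS.1 (eq_top_iff.2 fun z _ => h z).symm
    by_cases hyp : y ∈ p
    · let B : Submodule A M → Set (ResidueField A) := fun q => residue A '' {u | y + u • z ∈ q}
      have hB : ∀ q ∈ S, (B q).Finite := fun q hq => by
        refine Set.Subsingleton.finite ?_
        rintro _ ⟨u, hu, rfl⟩ _ ⟨v, hv, rfl⟩
        by_contra hne
        have hunit : IsUnit (u - v) := by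
          rw [← residue_ne_zero_iff_isUnit, map_sub]
          exact sub_ne_zero.2 hne
        have hzq : z ∈ q := by
          have h := q.sub_mem hu hv
          rw [add_sub_add_left_eq_sub, ← sub_smul] at h
          exact (q.smul_mem_iff_of_isUnit hunit).1 h
        exact hy q hq (by simpa using q.sub_mem hu (q.smul_mem u hzq))
      obtain ⟨t, ht⟩ := ((S.finite_toSet.biUnion hB).union (Set.finite_singleton 0)).exists_notMem
      rw [Set.mem_union, not_or] at ht
      obtain ⟨u, rfl⟩ := residue_surjective t
      refine ⟨y + u • z, fun q hq => ?_⟩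
      rcases Finset.mem_insert.1 hq with rfl | hq
      · intro h
        refine hz ((q.smul_mem_iff_of_isUnit ((residue_ne_zero_iff_isUnit u).1 ht.2)).1 ?_)
        simpa using q.sub_mem h hyp
      · intro h
        exact ht.1 (Set.mem_biUnion hq ⟨u, h, rfl⟩)
    · refine ⟨y, fun q hq => ?_⟩
      rcases Finset.mem_insert.1 hq with rfl | hq
      exacts [hyp, hy q hq]

/-- The degree one part of the Rees algebra. -/
noncomputable def reesDegreeOne (Q : Ideal A) : Q →ₗ[A] reesAlgebra Q where
  toFun x := ⟨monomial 1 x.1, reesAlgebra.monomial_mem.2 (by simp)⟩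
  map_add' x y := Subtype.ext (by simp)
  map_smul' r x := Subtype.ext (by simp [smul_monomial])

/-- The irrelevant ideal of the Rees algebra, generated in degree one. -/
noncomputable def reesIrrelevant (Q : Ideal A) : Ideal (reesAlgebra Q) :=
  Ideal.span (Set.range (reesDegreeOne Q))

lemma exists_mem_reesIrrelevant_pow {Q : Ideal A} (n : ℕ) {z : A} (hz : z ∈ Q ^ n) :
    ∃ r ∈ reesIrrelevant Q ^ n, (r : A[X]) = monomial n z := by
  induction n generalizing z with
  | zero => exact ⟨algebraMap A _ z, by simp, rfl⟩
  | succ n ih =>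
    rw [pow_succ'] at hz
    refine Submodule.mul_induction_on hz (fun q hq w hw => ?_) ?_
    · obtain ⟨r, hr, hrw⟩ := ih hw
      refine ⟨reesDegreeOne Q ⟨q, hq⟩ * r, ?_, ?_⟩
      · rw [pow_succ']
        exact Ideal.mul_mem_mul (Ideal.subset_span ⟨_, rfl⟩) hr
      · rw [Subalgebra.coe_mul, hrw]
        change monomial 1 q * monomial n w = _
        rw [monomial_mul_monomial, add_comm]
    · rintro u v ⟨r, hr, hru⟩ ⟨s, hs, hsv⟩
      exact ⟨r + s, Ideal.add_mem _ hr hs, by rw [Subalgebra.coe_add, hru, hsv, map_add]⟩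

lemma exists_pow_smul_regular {R M : Type*} [CommRing R] [IsNoetherianRing R] [AddCommGroup M]
    [Module R M] [Module.Finite R M] (𝔓 : Ideal R) (η : R)
    (hη : ∀ p ∈ associatedPrimes R M, η ∈ p → 𝔓 ≤ p) :
    ∃ c, ∀ n ≥ c, ∀ m ∈ 𝔓 ^ n • (⊤ : Submodule R M), η • m = 0 → m = 0 := by
  let N : Submodule R M := LinearMap.ker (LinearMap.lsmul R M η)
  have hN : ∀ {m}, m ∈ N ↔ η • m = 0 := Iff.rfl
  obtain ⟨k, hk⟩ : ∃ k, 𝔓 ^ k ≤ Module.annihilator R N := by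
    refine Ideal.exists_pow_le_of_le_radical_of_fg ?_ (IsNoetherian.noetherian _)
    rw [← Ideal.sInf_minimalPrimes]
    refine le_sInf fun p hp => hη p ?_ ?_
    · exact associatedPrimes.subset_of_injective N.subtype_injective
        (Module.associatedPrimes.minimalPrimes_annihilator_subset_associatedPrimes _ _ hp)
    · exact hp.1.2 (Module.mem_annihilator.2 fun m => Subtype.ext (hN.1 m.2))
  obtain ⟨k₀, hk₀⟩ := 𝔓.exists_pow_inf_eq_pow_smul N
  refine ⟨k₀ + k, fun n hn m hm hηm => ?_⟩
  have h1 : m ∈ 𝔓 ^ n • (⊤ : Submodule R M) ⊓ N := ⟨hm, hN.2 hηm⟩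
  rw [hk₀ n (by omega)] at h1
  have h2 : 𝔓 ^ (n - k₀) • (𝔓 ^ k₀ • (⊤ : Submodule R M) ⊓ N) ≤ ⊥ := by
    refine Submodule.smul_le.2 fun r hr m hm => ?_
    have hr' := hk (Ideal.pow_le_pow_right (by omega : k ≤ n - k₀) hr)
    exact congrArg Subtype.val (Module.mem_annihilator.1 hr' ⟨m, hm.2⟩)
  exact (Submodule.mem_bot R).1 (h2 h1)

lemma exists_finset_pow_mul_regular {R : Type*} [CommRing R] [IsNoetherianRing R] (K 𝔓 : Ideal R) :
    ∃ S : Finset (Ideal R), (∀ p ∈ S, ¬ 𝔓 ≤ p) ∧ ∀ η, (∀ p ∈ S, η ∉ p) →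
      ∃ c, ∀ n ≥ c, ∀ ζ ∈ 𝔓 ^ n, η * ζ ∈ K → ζ ∈ K := by
  have hfin := (associatedPrimes.finite R (R ⧸ K)).subset (Set.sep_subset _ fun p => ¬ 𝔓 ≤ p)
  refine ⟨hfin.toFinset, fun p hp => (hfin.mem_toFinset.1 hp).2, fun η hη => ?_⟩
  obtain ⟨c, hc⟩ := exists_pow_smul_regular (M := R ⧸ K) 𝔓 η fun p hp hηp => by
    by_contra hcon
    exact hη p (hfin.mem_toFinset.2 ⟨hp, hcon⟩) hηp
  refine ⟨c, fun n hn ζ hζ hK => ?_⟩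
  have h1 := hc n hn (K.mkQ ζ) ?_ ?_
  · rwa [Submodule.mkQ_apply, Submodule.Quotient.mk_eq_zero] at h1
  · have := Submodule.smul_mem_smul hζ (Submodule.mem_top (x := K.mkQ (1 : R)))
    rwa [← map_smul, smul_eq_mul, mul_one] at this
  · rwa [← map_smul, Submodule.mkQ_apply, Submodule.Quotient.mk_eq_zero, smul_eq_mul]

lemma exists_filter_regular [IsNoetherianRing A] [IsLocalRing A] [Infinite (ResidueField A)]
    {Q : Ideal A} {W : ℕ → Ideal A} (hW : ∀ n, Q * W n ≤ W (n + 1)) :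
    ∃ y ∈ Q, ∃ c, ∀ n ≥ c, ∀ z ∈ Q ^ n, y * z ∈ W (n + 1) → z ∈ W n := by
  classical
  let K : Ideal (reesAlgebra Q) :=
    (reesSubmodule Q W hW).comap (Algebra.linearMap (reesAlgebra Q) A[X])
  have hK : ∀ {r : reesAlgebra Q} {n z}, (r : A[X]) = monomial n z → (r ∈ K ↔ z ∈ W n) :=
    fun {r n z} h => by
      rw [Submodule.mem_comap, Algebra.linearMap_apply, algebraMap_reesAlgebra, h]
      exact monomial_mem_reesSubmodule
  obtain ⟨S, hS, hreg⟩ := exists_finset_pow_mul_regular K (reesIrrelevant Q)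
  obtain ⟨⟨y, hyQ⟩, hy⟩ := exists_forall_notMem_of_infinite_residueField
    (S.image fun p => (p.restrictScalars A).comap (reesDegreeOne Q)) (by
      rw [Finset.mem_image]
      rintro ⟨p, hp, htop⟩
      refine hS p hp (Ideal.span_le.2 ?_)
      rintro _ ⟨x, rfl⟩
      exact (htop ▸ Submodule.mem_top : x ∈ (p.restrictScalars A).comap (reesDegreeOne Q)))
  obtain ⟨c, hc⟩ := hreg (reesDegreeOne Q ⟨y, hyQ⟩) fun p hp hyp =>
    hy _ (Finset.mem_image_of_mem _ hp) hyp
  refine ⟨y, hyQ, c, fun n hn z hz hyz => ?_⟩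
  obtain ⟨ζ, hζ, hζz⟩ := exists_mem_reesIrrelevant_pow n hz
  refine (hK hζz).1 (hc n hn ζ hζ ((hK (n := n + 1) (z := y * z) ?_).2 hyz))
  rw [Subalgebra.coe_mul, hζz]
  change monomial 1 y * monomial n z = _
  rw [monomial_mul_monomial, add_comm]

end FilterRegular

section TwoGenerators

variable {A : Type*} [CommRing A]

lemma colength_span_pow_pair_le (x y : A) (n : ℕ) :
    colength (Ideal.span {x ^ n, y}) ≤ n * colength (Ideal.span {x, y}) := by
  induction n with
  | zero =>
    have : (Ideal.span {x ^ 0, y} : Ideal A) = ⊤ :=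
      (Ideal.eq_top_iff_one _).2 (Ideal.subset_span (by simp))
    rw [this, colength_top]; simp
  | succ n ih =>
    set D : Ideal A := Ideal.span {x ^ (n + 1), y}
    have hx : x ^ (n + 1) ∈ D := Ideal.subset_span (by simp)
    have hy : y ∈ D := Ideal.subset_span (by simp)
    have h := colength_add_colength_of_mul (D := D) (E := D.colon {x ^ n}) (F := ⊤) (x ^ n) le_top
      fun z _ => by
        rw [Submodule.mem_colon]
        simp [mul_comm]
    rw [colength_top, add_zero, Ideal.mul_top] at h
    rw [h, Nat.cast_succ, add_mul, one_mul]
    refine add_le_add (le_trans (colength_antitone ?_) ih) (colength_antitone ?_)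
    · rw [Ideal.span_le]
      rintro _ (rfl | rfl)
      · exact Ideal.mem_sup_right (Ideal.mem_span_singleton_self _)
      · exact Ideal.mem_sup_left hy
    · rw [Ideal.span_le]
      rintro _ (rfl | rfl)
      · exact Submodule.mem_colon.2 fun s hs => by
          rw [Set.mem_singleton_iff.1 hs, smul_eq_mul, ← pow_succ']; exact hx
      · exact Submodule.mem_colon.2 fun s hs => by
          rw [smul_eq_mul]; exact Ideal.mul_mem_right _ _ hy

lemma colength_mul_pow_le {𝔪 Q : Ideal A} {x y : A} (hx : x ∈ Q) (hxm : x ∈ 𝔪) (hy : y ∈ 𝔪)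
    {n : ℕ} (hn : n ≠ 0) (hfin : colength (Q ^ n) ≠ ⊤) :
    colength (𝔪 * Q ^ n) ≤ colength (Q ^ n) + 2 * (n * colength (Ideal.span {x, y})) := by
  set Q' : Ideal A := Ideal.span {x ^ n, y}
  have hxn : x ^ n ∈ Q ^ n := Ideal.pow_mem_pow hx n
  have hQ'm : Q' ≤ 𝔪 := by
    rw [Ideal.span_le]
    rintro _ (rfl | rfl)
    exacts [Ideal.pow_mem_of_mem _ hxm _ (Nat.pos_of_ne_zero hn), hy]
  have hyQ' : y ∈ Q' := Ideal.subset_span (by simp)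
  have h := colength_add_colength_of_mul (D := Q ^ n) (E := (Q ^ n).colon (Q' : Set A)) (F := ⊤) y
    le_top fun z _ => by
      rw [Submodule.mem_colon]
      refine ⟨fun h => by simpa [mul_comm] using h y hyQ', fun h s hs => ?_⟩
      obtain ⟨u, v, rfl⟩ := Ideal.mem_span_pair.1 hs
      rw [show z • (u * x ^ n + v * y) = z * u * x ^ n + v * (y * z) by rw [smul_eq_mul]; ring]
      exact Ideal.add_mem _ (Ideal.mul_mem_left _ _ hxn) (Ideal.mul_mem_left _ _ h)
  rw [colength_top, add_zero, Ideal.mul_top] at h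
  have hcolon : colength ((Q ^ n).colon (Q' : Set A)) ≠ ⊤ :=
    ne_top_of_le_ne_top hfin (h ▸ le_add_self)
  have h1 : colength (Q ^ n ⊔ Ideal.span {y}) ≤ colength Q' := colength_antitone (by
    rw [Ideal.span_le]
    rintro _ (rfl | rfl)
    exacts [Ideal.mem_sup_left hxn, Ideal.mem_sup_right (Ideal.mem_span_singleton_self _)])
  have h2 := (colength_mul_add_colon_le (x ^ n) y (Q ^ n)).1
  have h3 : colength (Q' * Q ^ n) ≤ colength (Q ^ n) + 2 * colength Q' := by
    refine (ENat.add_le_add_iff_right hcolon).1 (h2.trans ?_)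
    calc colength Q' + (colength (Q ^ n) + colength (Q ^ n))
        = colength Q' + colength (Q ^ n) + (colength (Q ^ n ⊔ Ideal.span {y}) +
            colength ((Q ^ n).colon (Q' : Set A))) := by rw [← h, add_assoc]
      _ ≤ colength Q' + colength (Q ^ n) + (colength Q' +
            colength ((Q ^ n).colon (Q' : Set A))) := by gcongr
      _ = _ := by ring
  refine (colength_antitone (Ideal.mul_mono_left hQ'm)).trans (h3.trans ?_)
  gcongr
  exact colength_span_pow_pair_le x y n

lemma exists_eq_of_linear_bound {a b w z : ℕ → ℕ} {c C : ℕ}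
    (h₁ : ∀ n ≥ c, b (n + 1) + a n = w (n + 1) + b n)
    (h₂ : ∀ n ≥ c, w (n + 1) + a n = z n + w n)
    (hab : ∀ n, a n ≤ b n) (haw : ∀ n, a n ≤ w n) (haz : ∀ n, a (n + 1) ≤ z n)
    (hb : ∀ n, n ≠ 0 → b n ≤ a n + 2 * (n * C)) : ∃ n, z n = a (n + 1) := by
  by_contra! hne
  have hz : ∀ n, a (n + 1) + 1 ≤ z n := fun n => lt_of_le_of_ne (haz n) (hne n).symm
  have hu : ∀ k, a (c + k) + k ≤ w (c + k) := fun k => by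
    induction k with
    | zero => exact haw _
    | succ k ih =>
      have := h₂ (c + k) (by omega)
      have := hz (c + k)
      rw [show c + (k + 1) = c + k + 1 from rfl]; omega
  have hd : ∀ k, 2 * a (c + k) + k * (k + 1) ≤ 2 * b (c + k) := fun k => by
    induction k with
    | zero => have := hab c; simpa using this
    | succ k ih =>
      have h3 := h₁ (c + k) (by omega)
      have h4 := hu (k + 1)
      rw [show c + (k + 1) = c + k + 1 from rfl] at h4 ⊢
      have h5 : (k + 1) * (k + 1 + 1) = k * (k + 1) + 2 * (k + 1) := by ring
      rw [h5]; omega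
  have h6 := hd (4 * C + 4 * (c * C) + 1)
  have h7 := hb (c + (4 * C + 4 * (c * C) + 1)) (by omega)
  have h8 : (4 * C + 4 * (c * C) + 1) * (4 * C + 4 * (c * C) + 1 + 1) ≤
      4 * ((c + (4 * C + 4 * (c * C) + 1)) * C) := by omega
  nlinarith [Nat.zero_le (C * (c * C)), Nat.zero_le (c * C * (c * C)), Nat.zero_le (c * C),
    Nat.zero_le C]

lemma exists_isReduction_span_pair [IsNoetherianRing A] [IsLocalRing A]
    [Infinite (ResidueField A)] {Q : Ideal A}
    (hfin : ∀ n, colength (maximalIdeal A * Q ^ n) ≠ ⊤) {x y : A} (hx : x ∈ Q)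
    (hxm : x ∈ maximalIdeal A) (hy : y ∈ maximalIdeal A)
    (hC : colength (Ideal.span {x, y}) ≠ ⊤) :
    ∃ y₁ y₂ : A, IsReduction (Ideal.span {y₁, y₂}) Q := by
  set 𝔪 := maximalIdeal A
  obtain ⟨y₁, hy₁Q, c₁, hc₁⟩ := exists_filter_regular (Q := Q) (W := fun n => 𝔪 * Q ^ n)
    fun n => by rw [mul_left_comm, ← pow_succ']
  let W : ℕ → Ideal A := fun n => match n with
    | 0 => 𝔪
    | n + 1 => 𝔪 * Q ^ (n + 1) ⊔ Ideal.span {y₁} * Q ^ n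
  have hy₁ : Ideal.span {y₁} ≤ Q := (Ideal.span_singleton_le_iff_mem _).2 hy₁Q
  have hW : ∀ n, Q * W n ≤ W (n + 1) := by
    rintro (_ | n)
    · exact le_sup_of_le_left (by simp [W, mul_comm])
    · simp only [W]
      rw [Ideal.mul_sup, mul_left_comm, ← pow_succ', mul_left_comm, ← pow_succ']
  have hWb : ∀ n, 𝔪 * Q ^ n ≤ W n := by
    rintro (_ | n)
    · simp [W]
    · exact le_sup_left
  have hWa : ∀ n, W (n + 1) ≤ Q ^ (n + 1) := fun n => sup_le Ideal.mul_le_right (by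
    rw [pow_succ']; exact Ideal.mul_mono_left hy₁)
  have hWa' : ∀ n, W n ≤ Q ^ n := by
    rintro (_ | n)
    · simp
    · exact hWa n
  obtain ⟨y₂, hy₂Q, c₂, hc₂⟩ := exists_filter_regular hW
  have hy₂ : Ideal.span {y₂} ≤ Q := (Ideal.span_singleton_le_iff_mem _).2 hy₂Q
  let Z : ℕ → Ideal A := fun n => W (n + 1) ⊔ Ideal.span {y₂} * Q ^ n
  have hZ : ∀ n, Z n ≤ Q ^ (n + 1) := fun n => sup_le (hWa n) (by
    rw [pow_succ']; exact Ideal.mul_mono_left hy₂)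
  have hfinW : ∀ n, colength (W n) ≠ ⊤ := fun n =>
    ne_top_of_le_ne_top (hfin n) (colength_antitone (hWb n))
  have hfinQ : ∀ n, colength (Q ^ n) ≠ ⊤ := fun n =>
    ne_top_of_le_ne_top (hfin n) (colength_antitone Ideal.mul_le_right)
  have hfinZ : ∀ n, colength (Z n) ≠ ⊤ := fun n =>
    ne_top_of_le_ne_top (hfinW (n + 1)) (colength_antitone le_sup_left)
  choose a ha using fun n => ENat.ne_top_iff_exists.1 (hfinQ n)
  choose b hb using fun n => ENat.ne_top_iff_exists.1 (hfin n)
  choose w hw using fun n => ENat.ne_top_iff_exists.1 (hfinW n)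
  choose z hz using fun n => ENat.ne_top_iff_exists.1 (hfinZ n)
  obtain ⟨C, hC⟩ := ENat.ne_top_iff_exists.1 hC
  obtain ⟨n, hn⟩ : ∃ n, z n = a (n + 1) := by
    refine exists_eq_of_linear_bound (b := b) (w := w) (c := max c₁ c₂) (C := C) (fun n hn => ?_)
      (fun n hn => ?_) (fun n => ?_) (fun n => ?_) (fun n => ?_) fun n hn => ?_
    · have := colength_add_colength_of_mul (D := 𝔪 * Q ^ (n + 1)) (E := 𝔪 * Q ^ n) (F := Q ^ n) y₁
        Ideal.mul_le_right fun z hz => ⟨fun h => by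
          rw [pow_succ', mul_left_comm]; exact Ideal.mul_mem_mul hy₁Q h,
          hc₁ n (le_trans (le_max_left _ _) hn) z hz⟩
      rw [← hb, ← ha, ← hb] at this
      have hw' := hw (n + 1)
      change _ = colength (𝔪 * Q ^ (n + 1) ⊔ Ideal.span {y₁} * Q ^ n) at hw'
      rw [← hw'] at this
      exact_mod_cast this
    · have := colength_add_colength_of_mul (D := W (n + 1)) (E := W n) (F := Q ^ n) y₂
        (hWa' n) fun z hz => ⟨fun h => hW n (Ideal.mul_mem_mul hy₂Q h),
          hc₂ n (le_trans (le_max_right _ _) hn) z hz⟩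
      have hz' := hz n
      change _ = colength (W (n + 1) ⊔ Ideal.span {y₂} * Q ^ n) at hz'
      rw [← hw (n + 1), ← ha, ← hw n, ← hz'] at this
      exact_mod_cast this
    · have := colength_antitone (Ideal.mul_le_right : 𝔪 * Q ^ n ≤ Q ^ n)
      rw [← ha, ← hb] at this
      exact_mod_cast this
    · have := colength_antitone (hWa' n)
      rw [← ha, ← hw] at this
      exact_mod_cast this
    · have := colength_antitone (hZ n)
      rw [← ha, ← hz] at this
      exact_mod_cast this
    · have := colength_mul_pow_le hx hxm hy hn (hfinQ n)
      rw [← ha, ← hb, ← hC] at this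
      exact_mod_cast this
  have hZQ : Z n = Q ^ (n + 1) :=
    eq_of_le_of_colength_le (hZ n) (hfinQ _) (by rw [← ha, ← hz, hn])
  refine ⟨y₁, y₂, isReduction_of_pow_le (n := n) ?_ ?_⟩
  · rw [Ideal.span_le]
    rintro _ (rfl | rfl)
    exacts [hy₁Q, hy₂Q]
  · refine Submodule.le_of_le_smul_of_le_jacobson_bot (I := 𝔪) (IsNoetherian.noetherian _)
      (IsLocalRing.jacobson_eq_maximalIdeal ⊥ bot_ne_top).ge ?_
    rw [Ideal.span_insert, Ideal.sup_mul, smul_eq_mul]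
    refine hZQ.ge.trans (le_of_eq ?_)
    simp only [Z, W]
    rw [sup_assoc, sup_comm]

end TwoGenerators

section HilbertSum

lemma exists_sum_eq_of_hilbertPolynomial {h q L : ℕ → ℕ} {c ℓ T : ℕ} {e₀ e₁ e₂ : ℤ} (h0 : h 0 = 0)
    (hL : ∀ n ≥ T, h n = L n) (hc : ∀ n, q (n + 1) + h n = c + (h (n + 1) + h (n + 1)))
    (hq : ∀ n, h (n + 2) ≤ q (n + 1)) (hqT : ∀ n ≥ T, q (n + 1) = h (n + 2)) (hℓ : h 1 ≤ ℓ)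
    (hpoly : ∃ N₀ : ℕ, ∀ n : ℕ, N₀ ≤ n →
      (L (n + 1) : ℤ) = e₀ * ((n + 2).choose 2 : ℕ) - e₁ * ((n + 1).choose 1 : ℕ)
        + e₂ * (n.choose 0 : ℕ)) :
    ∃ (N : ℕ) (p : ℕ → ℕ), (∀ n, N ≤ n → p n = 0) ∧ p 0 + h 1 = ℓ ∧
      (∀ n, p (n + 1) + h (n + 2) = q (n + 1)) ∧
      ((∑ n ∈ Finset.range N, p n : ℕ) : ℤ) = e₁ - e₀ + ℓ := by
  obtain ⟨N₀, hN₀⟩ := hpoly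
  let p : ℕ → ℕ := fun n => match n with
    | 0 => ℓ - h 1
    | n + 1 => q (n + 1) - h (n + 2)
  have hp0 : p 0 + h 1 = ℓ := Nat.sub_add_cancel hℓ
  have hp1 : ∀ n, p (n + 1) + h (n + 2) = q (n + 1) := fun n => Nat.sub_add_cancel (hq n)
  have hsum : ∀ N, ((∑ n ∈ Finset.range (N + 1), p n : ℕ) : ℤ) =
      N * c + ℓ - (h (N + 1) - h N) := fun N => by
    induction N with
    | zero =>
      have : (p 0 : ℤ) + h 1 = ℓ := by exact_mod_cast hp0
      simp [h0]; linarith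
    | succ N ih =>
      rw [Finset.sum_range_succ, Nat.cast_add, ih]
      have h1 : (p (N + 1) : ℤ) + h (N + 2) = q (N + 1) := by exact_mod_cast hp1 N
      have h2 : (q (N + 1) : ℤ) + h N = c + (h (N + 1) + h (N + 1)) := by exact_mod_cast hc N
      push_cast
      linarith
  have hdiff : ∀ n ≥ N₀ + T, (h (n + 2) : ℤ) - h (n + 1) = e₀ * (n + 2) - e₁ := fun n hn => by
    rw [hL _ (by omega), hL _ (by omega), hN₀ n (by omega), hN₀ (n + 1) (by omega)]
    rw [show n + 1 + 2 = (n + 2) + 1 from rfl, Nat.choose_succ_succ' (n + 2) 1]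
    simp only [Nat.choose_one_right, Nat.choose_zero_right]
    push_cast
    ring
  set M := N₀ + T
  have hce : (c : ℤ) = e₀ := by
    have h1 := hdiff M le_rfl
    have h2 := hdiff (M + 1) (by omega)
    have h3 : (q (M + 1 + 1) : ℤ) + h (M + 1) = c + (h (M + 1 + 1) + h (M + 1 + 1)) := by
      exact_mod_cast hc (M + 1)
    rw [hqT (M + 1) (by omega)] at h3
    push_cast at h2
    linarith
  refine ⟨M + 1 + 1, p, ?_, hp0, hp1, ?_⟩
  · rintro (_ | n) hn
    · omega
    · have := hp1 n
      rw [hqT n (by omega)] at this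
      omega
  · rw [hsum, hce]
    have h1 := hdiff M le_rfl
    push_cast
    linarith

end HilbertSum

section CohenMacaulay

open nonZeroDivisors

variable {A : Type*} [CommRing A]

lemma colength_eq_of_modLength_eq {E : Ideal A} {n : ℕ}
    (h : modLength A (A ⧸ E) = ((n : ℕ∞) : WithBot ℕ∞)) : colength E = n := by
  rw [modLength, ← Module.coe_length] at h
  exact WithBot.coe_injective h

lemma mem_radical_of_mem_idealIC {I : Ideal A} {x : A} (hx : x ∈ idealIC I) : x ∈ I.radical := by
  obtain ⟨m, -, c, hc, hxm⟩ := hx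
  refine ⟨m, ?_⟩
  rw [eq_neg_of_add_eq_zero_left hxm]
  refine neg_mem (Ideal.sum_mem _ fun i hi => Ideal.mul_mem_right _ _ ?_)
  exact Ideal.pow_le_self (Nat.one_le_iff_ne_zero.1 (Finset.mem_Icc.1 hi).1) (hc i hi)

lemma IsRegularSeq.mul_eq_zero {a : Fin 2 → A} (ha : IsRegularSeq a) (z : A) (hz : a 0 * z = 0) :
    z = 0 := by
  have h0 : {j : Fin 2 | j < 0} = ∅ := by ext j; simp
  have := ha.1 0 z (by rw [hz]; exact zero_mem _)
  simpa [h0] using this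

lemma IsRegularSeq.dvd_of_dvd_mul {a : Fin 2 → A} (ha : IsRegularSeq a) (z : A)
    (hz : a 0 ∣ a 1 * z) : a 0 ∣ z := by
  have h1 : {j : Fin 2 | j < 1} = {0} := by ext j; fin_cases j <;> simp
  have := ha.1 1 z
  simp only [h1, Set.image_singleton, Ideal.mem_span_singleton] at this
  exact this hz

lemma IsRegularSeq.maximalIdeal_le_radical [IsLocalRing A] (hdim : ringKrullDim A = 2)
    {a : Fin 2 → A} (ha : IsRegularSeq a) :
    maximalIdeal A ≤ (Ideal.span {a 0, a 1}).radical := by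
  set D : Ideal A := Ideal.span {a 0, a 1}
  have h1 := ringKrullDim_quotient_succ_le_of_nonZeroDivisor (r := a 0)
    (mem_nonZeroDivisors_iff_right.2 fun z hz => ha.mul_eq_zero z (by rwa [mul_comm]))
  have hle : Ideal.span {a 0} ≤ D := Ideal.span_mono (by simp)
  have h2 := ringKrullDim_succ_le_of_surjective (Ideal.Quotient.factor hle)
    (Ideal.Quotient.factor_surjective hle) (r := Ideal.Quotient.mk _ (a 1))
    (mem_nonZeroDivisors_iff_right.2 fun z hz => by
      obtain ⟨z, rfl⟩ := Ideal.Quotient.mk_surjective z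
      rw [← map_mul, Ideal.Quotient.eq_zero_iff_mem, Ideal.mem_span_singleton, mul_comm] at hz
      rw [Ideal.Quotient.eq_zero_iff_mem, Ideal.mem_span_singleton]
      exact ha.dvd_of_dvd_mul z hz)
    (by
      rw [Ideal.Quotient.factor_mk, Ideal.Quotient.eq_zero_iff_mem]
      exact Ideal.subset_span (by simp))
  have h0 : ringKrullDim (A ⧸ D) ≤ (0 : ℕ) := by
    by_contra hcon
    have h3 : 1 ≤ ringKrullDim (A ⧸ D) := by
      simpa using (ENat.WithBot.add_one_le_iff (n := 0)).2 (not_le.1 hcon)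
    have h4 : (1 + 1 + 1 : WithBot ℕ∞) ≤ 2 := by
      rw [← hdim]
      exact (add_le_add_left ((add_le_add_left h3 1).trans h2) 1).trans h1
    exact absurd h4 (by norm_num)
  have : Ring.KrullDimLE 0 (A ⧸ D) := Ring.krullDimLE_iff.2 h0
  rw [← Ideal.sInf_minimalPrimes]
  refine le_sInf fun p hp => ?_
  have hmax : p.IsMaximal :=
    (Ideal.krullDimLE_zero_quotient_iff_forall_minimalPrimes_isMaximal).1 this p hp
  exact (eq_maximalIdeal hmax).ge

end CohenMacaulay

section Main

variable {A : Type*} [CommRing A]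

lemma colength_ne_top_of_pow_le [IsLocalRing A]
    (hfin : ∀ n, colength (maximalIdeal A ^ n) ≠ ⊤) {k : ℕ} {E : Ideal A}
    (h : maximalIdeal A ^ k ≤ E) : colength E ≠ ⊤ :=
  ne_top_of_le_ne_top (hfin k) (colength_antitone h)

lemma IsMinimalReduction.exists_eq_span_pair [IsNoetherianRing A] [IsLocalRing A]
    [Infinite (ResidueField A)] (hdim : ringKrullDim A = 2) {a : Fin 2 → A}
    (ham : ∀ i, a i ∈ maximalIdeal A) (ha : IsRegularSeq a)
    (hfin : ∀ n, colength (maximalIdeal A ^ n) ≠ ⊤) {Q I : Ideal A} (hQ : IsMinimalReduction Q I)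
    {k : ℕ} (hk : maximalIdeal A ^ (k + 1) ≤ Q) : ∃ b₁ b₂, Q = Ideal.span {b₁, b₂} := by
  obtain ⟨l, hl⟩ := Ideal.exists_pow_le_of_le_radical_of_fg (ha.maximalIdeal_le_radical hdim)
    (IsNoetherian.noetherian _)
  obtain ⟨b₁, b₂, hb⟩ := exists_isReduction_span_pair (Q := Q) (x := a 0 ^ (k + 1)) (y := a 1)
    (fun n => colength_ne_top_of_pow_le hfin (k := 1 + (k + 1) * n) (by
      rw [pow_add, pow_one, pow_mul]
      exact Ideal.mul_mono_right (Ideal.pow_right_mono hk n)))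
    (hk (Ideal.pow_mem_pow (ham 0) _)) (Ideal.pow_mem_of_mem _ (ham 0) _ k.succ_pos) (ham 1)
    (ne_top_of_le_ne_top (WithTop.mul_ne_top (ENat.natCast_ne_top _)
      (colength_ne_top_of_pow_le hfin hl)) (colength_span_pow_pair_le _ _ _))
  exact ⟨b₁, b₂, (hQ.eq_of_isReduction hb).symm⟩

lemma map_redNum_le {Q I : Ideal A} {P : ℕ} {z : ℤ} (h : I ^ (P + 2) = Q * I ^ (P + 1))
    (hP : (P : ℤ) + 1 = z) :
    WithTop.map (fun m : ℕ => (m : ℤ)) (redNum Q I) ≤ (z : WithTop ℤ) := by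
  have h1 : redNum Q I ≤ ((P + 1 : ℕ) : ℕ∞) := sInf_le ⟨P + 1, rfl, h⟩
  obtain ⟨m, hm⟩ := ENat.ne_top_iff_exists.1 (ne_top_of_le_ne_top (ENat.natCast_ne_top _) h1)
  rw [← hm] at h1 ⊢
  have h2 : m ≤ P + 1 := by exact_mod_cast h1
  change (((m : ℕ) : ℤ) : WithTop ℤ) ≤ _
  rw [WithTop.coe_le_coe]
  omega

end Main

/-- **Corollary 3.6 (1).**  Let `(A, 𝔪)` be a two-dimensional Cohen–Macaulay
Noetherian local ring with infinite residue field, `I` an `𝔪`-primary ideal with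
a minimal reduction `Q`, and `J` an ideal with `I ⊆ J ⊆ Ī`.  If `ℓ_A(A/J^(n+1)) =
e₀·C(n+2,2) − e₁·C(n+1,1) + e₂·C(n,0)` for all large `n` (the Hilbert coefficients
of `J`) and `ℓ_A(A/I) = ℓI`, then `r_Q(I) ≤ e₁ − e₀ + ℓI + 1`. -/
theorem reduction_number_le_hilbert_coeffs {A : Type*} [CommRing A]
    [IsNoetherianRing A] [IsLocalRing A]
    (hdim : ringKrullDim A = 2)
    (hCM : ∃ a : Fin 2 → A, (∀ i, a i ∈ maximalIdeal A) ∧ IsRegularSeq a)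
    (hres : Infinite (ResidueField A))
    (I Q J : Ideal A) (hprim : I.IsPrimary) (hrad : I.radical = maximalIdeal A)
    (hQ : IsMinimalReduction Q I)
    (hIJ : I ≤ J) (hJic : (↑J : Set A) ⊆ idealIC I)
    (L : ℕ → ℕ) (hL : ∀ n : ℕ, modLength A (A ⧸ J ^ n) = ((L n : ℕ∞) : WithBot ℕ∞))
    (e₀ e₁ e₂ : ℤ)
    (hcoef : ∃ N₀ : ℕ, ∀ n : ℕ, N₀ ≤ n →
      (L (n + 1) : ℤ) = e₀ * ((n + 2).choose 2 : ℕ) - e₁ * ((n + 1).choose 1 : ℕ)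
        + e₂ * (n.choose 0 : ℕ))
    (ℓI : ℕ) (hℓI : modLength A (A ⧸ I) = ((ℓI : ℕ∞) : WithBot ℕ∞)) :
    WithTop.map (fun m : ℕ => (m : ℤ)) (redNum Q I)
      ≤ ((e₁ - e₀ + (ℓI : ℤ) + 1 : ℤ) : WithTop ℤ) := by
  obtain ⟨a, ham, ha⟩ := hCM
  replace hL : ∀ n, colength (J ^ n) = L n := fun n => colength_eq_of_modLength_eq (hL n)
  replace hℓI : colength I = ℓI := colength_eq_of_modLength_eq hℓI
  have hJm : J ≤ maximalIdeal A := fun x hx => hrad ▸ mem_radical_of_mem_idealIC (hJic hx)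
  have hfin : ∀ n, colength (maximalIdeal A ^ n) ≠ ⊤ := fun n =>
    ne_top_of_le_ne_top (by rw [hL n]; exact ENat.natCast_ne_top _)
      (colength_antitone (Ideal.pow_right_mono hJm n))
  have hQI : Q ≤ I := hQ.1.1
  have hQJ : Q ≤ J := hQI.trans hIJ
  obtain ⟨K, hK⟩ := (hQ.1.trans (isReduction_of_subset_idealIC hIJ hJic)).2
  obtain ⟨k, hk⟩ : ∃ k, maximalIdeal A ^ (k + 1) ≤ Q := by
    obtain ⟨i, hi⟩ := Ideal.exists_pow_le_of_le_radical_of_fg hrad.ge (IsNoetherian.noetherian _)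
    obtain ⟨r, hr⟩ := hQ.1.2
    refine ⟨i * (r + 1), (Ideal.pow_le_pow_right (Nat.le_succ _)).trans ?_⟩
    rw [pow_mul]
    exact (Ideal.pow_right_mono hi _).trans (hr.le.trans Ideal.mul_le_left)
  obtain ⟨b₁, b₂, hb⟩ := hQ.exists_eq_span_pair hdim ham ha hfin hk
  have hx0 := ha.mul_eq_zero
  have hreg := eq_zero_of_pow_mul_eq_zero hx0 (k + 1)
  have hxQ : a 0 ^ (k + 1) ∈ Q := hk (Ideal.pow_mem_pow (ham 0) _)
  have hyQ : a 1 ^ (k + 1) ∈ Q := hk (Ideal.pow_mem_pow (ham 1) _)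
  have hsyz := exists_syzygy_of_mem_span_pair hreg
    (pow_dvd_of_pow_dvd_pow_mul hx0 ha.dvd_of_dvd_mul (k + 1) (k + 1)) (hb ▸ hxQ) (hb ▸ hyQ)
  obtain ⟨T, hT⟩ := exists_pow_colon_le hK hxQ hreg
  obtain ⟨F, hF⟩ : ∃ F : ℕ → Ideal A,
      ∀ n, F n = (J ^ (n + T)).colon ((J ^ T : Ideal A) : Set A) := ⟨_, fun _ => rfl⟩
  obtain ⟨hF0, hJF, hmul, hcolon, hFT⟩ := ratliffRush_properties hQJ hT F hF
  have hQF : ∀ n, Q * F n ≤ F (n + 1) := fun n => (Ideal.mul_mono_left hQJ).trans (hmul n)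
  have hIF : I ≤ F 1 := hIJ.trans (by simpa using hJF 1)
  have hQcol : colength Q ≠ ⊤ := colength_ne_top_of_pow_le hfin hk
  have hfinF : ∀ n, colength (F n) ≠ ⊤ := fun n =>
    ne_top_of_le_ne_top (by rw [hL n]; exact ENat.natCast_ne_top _) (colength_antitone (hJF n))
  have hfinQF : ∀ n, colength (Q * F (n + 1)) ≠ ⊤ := fun n =>
    colength_ne_top_of_pow_le hfin (k := (k + 1) * (n + 2)) (by
      rw [pow_mul, pow_succ']
      exact Ideal.mul_mono hk ((Ideal.pow_right_mono (hk.trans hQJ) _).trans (hJF _)))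
  obtain ⟨c, hc⟩ := ENat.ne_top_iff_exists.1 hQcol
  choose h hh using fun n => ENat.ne_top_iff_exists.1 (hfinF n)
  choose q hq using fun n => ENat.ne_top_iff_exists.1 (hfinQF n)
  have hFpow : ∀ n ≥ max T K, F (n + 2) = Q * F (n + 1) := fun n hn => by
    obtain ⟨hnT, hnK⟩ := max_le_iff.1 hn
    rw [hFT _ (by omega), hFT _ (by omega)]
    obtain ⟨j, rfl⟩ := Nat.exists_eq_add_of_le hnK
    rw [show K + j + 2 = j + 2 + K by omega, show K + j + 1 = j + 1 + K by omega,
      pow_add_eq_of_pow_succ_eq hK, pow_add_eq_of_pow_succ_eq hK, pow_succ' Q (j + 1), mul_assoc]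
  obtain ⟨N, p, hpN, hp0, hp1, hsum⟩ := exists_sum_eq_of_hilbertPolynomial (h := h)
    (q := fun n => q (n - 1)) (L := L) (c := c) (ℓ := ℓI) (T := max T K)
    (by have := hh 0; rw [hF0, colength_top] at this; exact_mod_cast this)
    (fun n hn => by
      have := hh n
      rw [hFT n ((le_max_left _ _).trans hn), hL] at this
      exact_mod_cast this)
    (fun n => by
      have := (colength_mul_add_colon_le b₁ b₂ (F (n + 1))).2 hsyz
      rw [← hb, hcolon n, ← hc, ← hh, ← hh, ← hq] at this
      exact_mod_cast this)
    (fun n => by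
      have := colength_antitone (hQF (n + 1))
      rw [← hh, ← hq] at this
      exact_mod_cast this)
    (fun n hn => by
      have := hh (n + 2)
      rw [hFpow n hn, ← hq] at this
      exact_mod_cast this.symm)
    (by
      have := colength_antitone hIF
      rw [← hh, hℓI] at this
      exact_mod_cast this) hcoef
  obtain ⟨f₀, hf₀⟩ := exists_generators_of_colength hIF (p 0) (hfinF 1) (by
    rw [hℓI, ← hh, ← hp0, add_comm]; push_cast; rfl)
  choose f hf using fun n => exists_generators_of_colength (hQF (n + 1)) (p (n + 1))
    (hfinF (n + 2)) (by
      rw [← hq, ← hh]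
      exact_mod_cast ((add_comm _ _).trans (hp1 n)).ge)
  have hle := pow_sum_add_two_le hQI F (fun n => (Ideal.mul_mono_left hIJ).trans (hmul n)) N p
    (fun n => match n with
      | 0 => f₀
      | n + 1 => f n) hf₀ hf hpN
  refine map_redNum_le (hle.antisymm ?_) (by rw [hsum])
  rw [pow_succ' I (_ + 1)]
  exact Ideal.mul_mono_left hQI
end
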